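/- arXiv:2302.13103 — 2 statements merged into one kernel-verified Lean document; each statement's English description precedes it below -/
import Mathlib

section
/- Let V, Y : W → ℝ be real-valued Γ-periodic potentials on ℤ² that are Tri-Floquet isospectral (i.e., Floquet isospectral for the triangular-lattice Laplacian). If Y is separable, then V is separable. -/
open scoped BigOperators

noncomputable section

namespace TriDPSO

/-- The Floquet matrix `𝒟_{Tri,V}(z)` of the periodic Schrödinger operator on the triangular
lattice, indexed by the fundamental domain `W = ZMod q₁ × ZMod q₂`. -/
def triMat (q1 q2 : ℕ) [NeZero q1] [NeZero q2] (V : ZMod q1 × ZMod q2 → ℂ)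
    (z1 z2 : ℂ) : Matrix (ZMod q1 × ZMod q2) (ZMod q1 × ZMod q2) ℂ :=
  fun n n' =>
    (if n' = n + (1, 0) then (if n.1.val = q1 - 1 then z1 else 1) else 0)
    + (if n' = n - (1, 0) then (if n.1.val = 0 then z1⁻¹ else 1) else 0)
    + (if n' = n + (0, 1) then (if n.2.val = q2 - 1 then z2 else 1) else 0)
    + (if n' = n - (0, 1) then (if n.2.val = 0 then z2⁻¹ else 1) else 0)
    + (if n' = n + (1, 0) - (0, 1) then
        (if n.1.val = q1 - 1 then z1 else 1) * (if n.2.val = 0 then z2⁻¹ else 1) else 0)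
    + (if n' = n - (1, 0) + (0, 1) then
        (if n.1.val = 0 then z1⁻¹ else 1) * (if n.2.val = q2 - 1 then z2 else 1) else 0)
    + (if n' = n then V n else 0)

/-- Tri-Floquet isospectrality: for every real quasimomentum `k = (k₁,k₂)` the triangular
Floquet matrices have the same characteristic polynomial. -/
def TriFloquetIso (q1 q2 : ℕ) [NeZero q1] [NeZero q2]
    (V Y : ZMod q1 × ZMod q2 → ℂ) : Prop :=
  ∀ k1 k2 : ℝ,
    (triMat q1 q2 V (Complex.exp (2 * Real.pi * Complex.I * k1))
        (Complex.exp (2 * Real.pi * Complex.I * k2))).charpoly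
      = (triMat q1 q2 Y (Complex.exp (2 * Real.pi * Complex.I * k1))
          (Complex.exp (2 * Real.pi * Complex.I * k2))).charpoly

/-- `V : W → ℂ` is separable if `V(n₁,n₂) = V₁(n₁) + V₂(n₂)`. -/
def TriSeparable (q1 q2 : ℕ) (V : ZMod q1 × ZMod q2 → ℂ) : Prop :=
  ∃ (V1 : ZMod q1 → ℂ) (V2 : ZMod q2 → ℂ), ∀ n : ZMod q1 × ZMod q2, V n = V1 n.1 + V2 n.2

/-- The discrete Fourier transform of `V`. -/
def triDft (q1 q2 : ℕ) [NeZero q1] [NeZero q2] (V : ZMod q1 × ZMod q2 → ℂ)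
    (l : ZMod q1 × ZMod q2) : ℂ :=
  (1 / ((q1 : ℂ) * (q2 : ℂ))) * ∑ n : ZMod q1 × ZMod q2, V n *
    Complex.exp (-(2 * Real.pi * Complex.I) *
      ((l.1.val : ℂ) * (n.1.val : ℂ) / (q1 : ℂ) + (l.2.val : ℂ) * (n.2.val : ℂ) / (q2 : ℂ)))

/-- The average `[V]` of a potential. -/
def triAvg (q1 q2 : ℕ) [NeZero q1] [NeZero q2] (V : ZMod q1 × ZMod q2 → ℂ) : ℂ :=
  (1 / ((q1 : ℂ) * (q2 : ℂ))) * ∑ n : ZMod q1 × ZMod q2, V n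

/-- `ρ¹_m = e^{2πi m/q₁}`, `ρ²_m = e^{2πi m/q₂}`. -/
def triRho (qq : ℕ) (m : ℕ) : ℂ :=
  Complex.exp (2 * Real.pi * Complex.I * (m : ℂ) / (qq : ℂ))

/-- The diagonal matrix `A_{Tri}(z)`. -/
def triA (q1 q2 : ℕ) [NeZero q1] [NeZero q2] (z1 z2 : ℂ) :
    Matrix (ZMod q1 × ZMod q2) (ZMod q1 × ZMod q2) ℂ :=
  Matrix.diagonal (fun n =>
    triRho q1 n.1.val * z1 + (triRho q1 n.1.val * z1)⁻¹
      + triRho q2 n.2.val * z2 + (triRho q2 n.2.val * z2)⁻¹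
      + (triRho q2 n.2.val * z2) / (triRho q1 n.1.val * z1)
      + (triRho q1 n.1.val * z1) / (triRho q2 n.2.val * z2))

/-- The matrix `B_V` with entries `V̂(n − n')`. -/
def triB (q1 q2 : ℕ) [NeZero q1] [NeZero q2] (V : ZMod q1 × ZMod q2 → ℂ) :
    Matrix (ZMod q1 × ZMod q2) (ZMod q1 × ZMod q2) ℂ :=
  fun n n' => triDft q1 q2 V (n - n')


open Filter Topology Matrix

section Characters

variable {q1 q2 : ℕ} [NeZero q1] [NeZero q2]

/-- The character `n ↦ e^{2πi (l₁n₁/q₁ + l₂n₂/q₂)}` of `W`. -/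
def chi (l n : ZMod q1 × ZMod q2) : ℂ :=
  ZMod.stdAddChar (l.1 * n.1) * ZMod.stdAddChar (l.2 * n.2)

lemma chi_comm (l n : ZMod q1 × ZMod q2) : chi l n = chi n l := by
  simp only [chi, mul_comm]

lemma chi_add_left (l m n : ZMod q1 × ZMod q2) : chi (l + m) n = chi l n * chi m n := by
  simp only [chi, Prod.fst_add, Prod.snd_add, add_mul, AddChar.map_add_eq_mul]
  ring

lemma chi_add_right (l m n : ZMod q1 × ZMod q2) : chi l (m + n) = chi l m * chi l n := by
  rw [chi_comm, chi_add_left, chi_comm m, chi_comm n]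

lemma chi_neg_left (l n : ZMod q1 × ZMod q2) : chi (-l) n = chi l (-n) := by
  simp [chi]

lemma star_stdAddChar {q : ℕ} [NeZero q] (a : ZMod q) :
    (starRingEnd ℂ) (ZMod.stdAddChar a) = ZMod.stdAddChar (-a) := by
  rw [ZMod.stdAddChar_apply, ZMod.stdAddChar_apply, AddChar.map_neg_eq_inv, Circle.coe_inv_eq_conj]

lemma stdAddChar_ne_zero {q : ℕ} [NeZero q] (a : ZMod q) : ZMod.stdAddChar a ≠ (0 : ℂ) := by
  rw [ZMod.stdAddChar_apply]
  exact Circle.coe_ne_zero _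

lemma star_chi (l n : ZMod q1 × ZMod q2) : (starRingEnd ℂ) (chi l n) = chi (-l) n := by
  simp [chi, star_stdAddChar]

lemma sum_stdAddChar_mul {q : ℕ} [NeZero q] (b : ZMod q) :
    ∑ a : ZMod q, (ZMod.stdAddChar (a * b) : ℂ) = if b = 0 then (q : ℂ) else 0 := by
  have h := AddChar.sum_mulShift (R' := ℂ) b (ZMod.isPrimitive_stdAddChar q)
  rw [h, ZMod.card]
  split_ifs <;> simp

lemma sum_chi (n : ZMod q1 × ZMod q2) :
    ∑ l, chi l n = if n = 0 then (q1 * q2 : ℂ) else 0 := by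
  simp only [chi, Fintype.sum_prod_type, ← Finset.mul_sum, ← Finset.sum_mul, sum_stdAddChar_mul]
  by_cases h1 : n.1 = 0 <;> by_cases h2 : n.2 = 0 <;> simp [Prod.ext_iff, h1, h2]

/-- The Fourier coefficients of `V` with respect to the characters `chi`. -/
def coeffs (V : ZMod q1 × ZMod q2 → ℂ) (l : ZMod q1 × ZMod q2) : ℂ :=
  (q1 * q2 : ℂ)⁻¹ * ∑ n, V n * chi (-l) n

lemma card_ne_zero : (q1 * q2 : ℂ) ≠ 0 :=
  mul_ne_zero (Nat.cast_ne_zero.2 (NeZero.ne q1)) (Nat.cast_ne_zero.2 (NeZero.ne q2))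

lemma sum_chi_mul_coeffs (V : ZMod q1 × ZMod q2 → ℂ) (l n : ZMod q1 × ZMod q2) :
    ∑ m, chi m n * coeffs V (m - l) = V n * chi l n := by
  have key : ∀ m, chi m n * coeffs V (m - l)
      = (q1 * q2 : ℂ)⁻¹ * ∑ k, V k * chi l k * chi m (n - k) := by
    intro m
    rw [coeffs, mul_left_comm, Finset.mul_sum]
    congr 1
    refine Finset.sum_congr rfl fun k _ => ?_
    rw [neg_sub, sub_eq_add_neg l m, chi_add_left, chi_neg_left, sub_eq_add_neg n k,
      chi_add_right]
    ring
  simp only [key]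
  rw [← Finset.mul_sum, Finset.sum_comm]
  simp only [← Finset.mul_sum, sum_chi, sub_eq_zero, mul_ite, mul_zero, Finset.sum_ite_eq,
    Finset.mem_univ, if_true]
  rw [mul_comm (V n * chi l n), inv_mul_cancel_left₀ card_ne_zero]

lemma chi_zero_left (n : ZMod q1 × ZMod q2) : chi 0 n = 1 := by simp [chi]

lemma sum_coeffs_mul_chi (V : ZMod q1 × ZMod q2 → ℂ) (n : ZMod q1 × ZMod q2) :
    ∑ m, coeffs V m * chi m n = V n := by
  have h := sum_chi_mul_coeffs V 0 n
  simpa [chi_zero_left, mul_comm] using h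

lemma star_coeffs (V : ZMod q1 × ZMod q2 → ℝ) (l : ZMod q1 × ZMod q2) :
    (starRingEnd ℂ) (coeffs (fun n => (V n : ℂ)) l) = coeffs (fun n => (V n : ℂ)) (-l) := by
  simp [coeffs, star_chi, map_sum]

lemma coeffs_mul_coeffs_neg (V : ZMod q1 × ZMod q2 → ℝ) (l : ZMod q1 × ZMod q2) :
    coeffs (fun n => (V n : ℂ)) l * coeffs (fun n => (V n : ℂ)) (-l)
      = ((Complex.normSq (coeffs (fun n => (V n : ℂ)) l) : ℝ) : ℂ) := by
  rw [← star_coeffs, Complex.mul_conj]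

/-- The mixed Fourier coefficients of a separable potential vanish. -/
lemma TriSeparable.coeffs_eq_zero {V : ZMod q1 × ZMod q2 → ℂ} (h : TriSeparable q1 q2 V)
    {l : ZMod q1 × ZMod q2} (h1 : l.1 ≠ 0) (h2 : l.2 ≠ 0) : coeffs V l = 0 := by
  obtain ⟨V1, V2, hV⟩ := h
  have e1 : ∑ n : ZMod q1, (ZMod.stdAddChar (-(l.1 * n)) : ℂ) = 0 := by
    have := sum_stdAddChar_mul (-l.1)
    simpa [h1, mul_comm] using this
  have e2 : ∑ n : ZMod q2, (ZMod.stdAddChar (-(l.2 * n)) : ℂ) = 0 := by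
    have := sum_stdAddChar_mul (-l.2)
    simpa [h2, mul_comm] using this
  have s1 : ∑ n : ZMod q1 × ZMod q2, V1 n.1 * chi (-l) n = 0 := by
    simp [chi, Fintype.sum_prod_type, ← Finset.mul_sum, e2]
  have s2 : ∑ n : ZMod q1 × ZMod q2, V2 n.2 * chi (-l) n = 0 := by
    simp [chi, Fintype.sum_prod_type_right, ← Finset.mul_sum, ← Finset.sum_mul, e1]
  simp [coeffs, hV, add_mul, Finset.sum_add_distrib, s1, s2]

/-- A potential whose mixed Fourier coefficients vanish is separable. -/
lemma triSeparable_of_coeffs_eq_zero {V : ZMod q1 × ZMod q2 → ℂ}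
    (h : ∀ l : ZMod q1 × ZMod q2, l.1 ≠ 0 → l.2 ≠ 0 → coeffs V l = 0) :
    TriSeparable q1 q2 V := by
  refine ⟨fun a => ∑ m, if m.2 = 0 then coeffs V m * chi m (a, 0) else 0,
    fun b => ∑ m, if m.2 = 0 then 0 else coeffs V m * chi m (0, b), fun n => ?_⟩
  rw [← Finset.sum_add_distrib, ← sum_coeffs_mul_chi V n]
  refine Finset.sum_congr rfl fun m _ => ?_
  by_cases h2 : m.2 = 0
  · simp [chi, h2]
  · by_cases h1 : m.1 = 0
    · simp [chi, h1, h2]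
    · simp [h m h1 h2]

end Characters

section Diagonalization

variable {q1 q2 : ℕ} [NeZero q1] [NeZero q2]

lemma twist_mul_pow_val_add_one {q : ℕ} [NeZero q] (w : ℂ) (a : ZMod q) :
    (if a.val = q - 1 then w ^ q else 1) * w ^ (a + 1).val = w * w ^ a.val := by
  have hq : 0 < q := Nat.pos_of_ne_zero (NeZero.ne q)
  have hlt := a.val_lt
  have hval : (a + 1).val = (a.val + 1) % q := by
    rw [ZMod.val_add, ZMod.val_one_eq_one_mod, Nat.add_mod_mod]
  split_ifs with h
  · rw [hval, h, Nat.sub_add_cancel hq, Nat.mod_self, pow_zero, mul_one, ← pow_succ',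
      Nat.sub_add_cancel hq]
  · rw [hval, Nat.mod_eq_of_lt (by omega), one_mul, pow_succ']

lemma twist_mul_pow_val_sub_one {q : ℕ} [NeZero q] {w : ℂ} (hw : w ≠ 0) (a : ZMod q) :
    (if a.val = 0 then (w ^ q)⁻¹ else 1) * w ^ (a - 1).val = w⁻¹ * w ^ a.val := by
  obtain ⟨b, rfl⟩ : ∃ b, a = b + 1 := ⟨a - 1, by ring⟩
  have hlt := b.val_lt
  have hiff : (b + 1).val = 0 ↔ b.val = q - 1 := by
    have hval : (b + 1).val = (b.val + 1) % q := by
      rw [ZMod.val_add, ZMod.val_one_eq_one_mod, Nat.add_mod_mod]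
    rw [hval]
    constructor
    · intro h
      by_contra hne
      rw [Nat.mod_eq_of_lt (by omega)] at h
      omega
    · intro h
      rw [h, Nat.sub_add_cancel (by omega), Nat.mod_self]
  have h := twist_mul_pow_val_add_one w b
  rw [add_sub_cancel_right]
  simp only [hiff]
  split_ifs at h ⊢ with hb
  · field_simp
    linear_combination -h
  · field_simp
    linear_combination -h

/-- The eigenvalue of the free operator on the Bloch wave with character `l`. -/
def symb (w1 w2 : ℂ) (l : ZMod q1 × ZMod q2) : ℂ :=
  ZMod.stdAddChar l.1 * w1 + (ZMod.stdAddChar l.1 * w1)⁻¹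
    + ZMod.stdAddChar l.2 * w2 + (ZMod.stdAddChar l.2 * w2)⁻¹
    + (ZMod.stdAddChar l.1 * w1) * (ZMod.stdAddChar l.2 * w2)⁻¹
    + (ZMod.stdAddChar l.1 * w1)⁻¹ * (ZMod.stdAddChar l.2 * w2)

/-- The matrix whose columns are the Bloch waves. -/
def bloch (q1 q2 : ℕ) [NeZero q1] [NeZero q2] (w1 w2 : ℂ) :
    Matrix (ZMod q1 × ZMod q2) (ZMod q1 × ZMod q2) ℂ :=
  fun n l => w1 ^ n.1.val * w2 ^ n.2.val * chi l n

/-- The matrix of multiplication by `V` in the basis of characters. -/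
def coeffMat (V : ZMod q1 × ZMod q2 → ℂ) :
    Matrix (ZMod q1 × ZMod q2) (ZMod q1 × ZMod q2) ℂ :=
  fun m l => coeffs V (m - l)

lemma triMat_mul_bloch_apply (V : ZMod q1 × ZMod q2 → ℂ) {w1 w2 : ℂ} (h1 : w1 ≠ 0)
    (h2 : w2 ≠ 0) (n l : ZMod q1 × ZMod q2) :
    (triMat q1 q2 V (w1 ^ q1) (w2 ^ q2) * bloch q1 q2 w1 w2) n l
      = (symb w1 w2 l + V n) * bloch q1 q2 w1 w2 n l := by
  have f1 := twist_mul_pow_val_add_one w1 n.1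
  have f2 := twist_mul_pow_val_add_one w2 n.2
  have b1 := twist_mul_pow_val_sub_one h1 n.1
  have b2 := twist_mul_pow_val_sub_one h2 n.2
  simp only [Matrix.mul_apply, triMat, add_mul, ite_mul, zero_mul, Finset.sum_add_distrib,
    Finset.sum_ite_eq', Finset.mem_univ, if_true]
  simp only [← ite_mul, bloch, chi, symb, Prod.fst_add, Prod.snd_add, Prod.fst_sub, Prod.snd_sub,
    add_zero, sub_zero, mul_add, mul_sub, mul_one, AddChar.map_add_eq_mul,
    AddChar.map_sub_eq_div]
  generalize (if n.1.val = q1 - 1 then w1 ^ q1 else 1) = F1 at *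
  generalize (if n.2.val = q2 - 1 then w2 ^ q2 else 1) = F2 at *
  generalize (if n.1.val = 0 then (w1 ^ q1)⁻¹ else 1) = B1 at *
  generalize (if n.2.val = 0 then (w2 ^ q2)⁻¹ else 1) = B2 at *
  generalize w1 ^ (n.1 + 1).val = P1 at *
  generalize w2 ^ (n.2 + 1).val = P2 at *
  generalize w1 ^ (n.1 - 1).val = M1 at *
  generalize w2 ^ (n.2 - 1).val = M2 at *
  simp only [mul_inv, div_eq_mul_inv]
  generalize (ZMod.stdAddChar l.1 : ℂ) = e1
  generalize (ZMod.stdAddChar l.2 : ℂ) = e2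
  generalize (ZMod.stdAddChar (l.1 * n.1) : ℂ) = c1
  generalize (ZMod.stdAddChar (l.2 * n.2) : ℂ) = c2
  generalize w1 ^ n.1.val = p1 at *
  generalize w2 ^ n.2.val = p2 at *
  linear_combination c1 * c2 * (e1 * p2 * f1 + e1⁻¹ * p2 * b1 + e2 * p1 * f2 + e2⁻¹ * p1 * b2
    + e1 * e2⁻¹ * (F1 * P1 * b2 + w2⁻¹ * p2 * f1) + e1⁻¹ * e2 * (B1 * M1 * f2 + w2 * p2 * b1))

lemma triMat_mul_bloch (V : ZMod q1 × ZMod q2 → ℂ) {w1 w2 : ℂ} (h1 : w1 ≠ 0)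
    (h2 : w2 ≠ 0) :
    triMat q1 q2 V (w1 ^ q1) (w2 ^ q2) * bloch q1 q2 w1 w2
      = bloch q1 q2 w1 w2 * (diagonal (symb w1 w2) + coeffMat V) := by
  ext n l
  rw [triMat_mul_bloch_apply V h1 h2, Matrix.mul_add, Matrix.add_apply, Matrix.mul_diagonal,
    Matrix.mul_apply]
  simp only [bloch, coeffMat, mul_assoc, ← Finset.mul_sum, sum_chi_mul_coeffs]
  ring

lemma det_bloch_ne_zero {w1 w2 : ℂ} (h1 : w1 ≠ 0) (h2 : w2 ≠ 0) :
    (bloch q1 q2 w1 w2).det ≠ 0 := by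
  have h : bloch q1 q2 w1 w2 *
      Matrix.of (fun l n => (q1 * q2 : ℂ)⁻¹ * (w1 ^ n.1.val * w2 ^ n.2.val)⁻¹ * chi l (-n)) = 1 := by
    ext n k
    have key : ∀ l : ZMod q1 × ZMod q2, bloch q1 q2 w1 w2 n l *
        ((q1 * q2 : ℂ)⁻¹ * (w1 ^ k.1.val * w2 ^ k.2.val)⁻¹ * chi l (-k))
        = w1 ^ n.1.val * w2 ^ n.2.val * ((q1 * q2 : ℂ)⁻¹ * (w1 ^ k.1.val * w2 ^ k.2.val)⁻¹)
          * chi l (n - k) := by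
      intro l
      rw [bloch, sub_eq_add_neg, chi_add_right]
      ring
    simp only [Matrix.mul_apply, Matrix.of_apply, key]
    rw [← Finset.mul_sum, sum_chi, Matrix.one_apply]
    simp only [sub_eq_zero]
    split_ifs with hnk
    · subst hnk
      have hq := card_ne_zero (q1 := q1) (q2 := q2)
      have hp : w1 ^ n.1.val * w2 ^ n.2.val ≠ 0 := mul_ne_zero (pow_ne_zero _ h1) (pow_ne_zero _ h2)
      rw [mul_comm (q1 * q2 : ℂ)⁻¹, mul_inv_cancel_left₀ hp, inv_mul_cancel₀ hq]
    · simp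
  exact Matrix.det_ne_zero_of_right_inverse h

lemma eval_charpoly_triMat (V : ZMod q1 × ZMod q2 → ℂ) {w1 w2 : ℂ} (h1 : w1 ≠ 0) (h2 : w2 ≠ 0)
    (μ : ℂ) :
    (triMat q1 q2 V (w1 ^ q1) (w2 ^ q2)).charpoly.eval μ
      = (scalar _ μ - (diagonal (symb w1 w2) + coeffMat V)).det := by
  rw [Matrix.eval_charpoly]
  have h : (scalar _ μ - triMat q1 q2 V (w1 ^ q1) (w2 ^ q2)) * bloch q1 q2 w1 w2
      = bloch q1 q2 w1 w2 * (scalar _ μ - (diagonal (symb w1 w2) + coeffMat V)) := by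
    rw [sub_mul, mul_sub, triMat_mul_bloch V h1 h2, (scalar_commute μ (Commute.all μ) _).eq]
  have hdet := congrArg Matrix.det h
  rw [det_mul, det_mul, mul_comm] at hdet
  exact mul_left_cancel₀ (det_bloch_ne_zero h1 h2) hdet

end Diagonalization

section Extension

variable {q1 q2 : ℕ} [NeZero q1] [NeZero q2]

lemma eq_of_differentiable_of_eq_ofReal {f g : ℂ → ℂ} (hf : Differentiable ℂ f)
    (hg : Differentiable ℂ g) (h : ∀ x : ℝ, f x = g x) : f = g := by
  refine AnalyticOnNhd.eq_of_frequently_eq (z₀ := 0)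
    (fun z _ => hf.analyticAt z) (fun z _ => hg.analyticAt z) ?_
  have hreal : ∃ᶠ x : ℝ in 𝓝[≠] 0, f x = g x := Eventually.frequently (.of_forall h)
  have htend : Tendsto (fun x : ℝ => (x : ℂ)) (𝓝[≠] 0) (𝓝[≠] 0) := by
    refine tendsto_nhdsWithin_iff.2 ⟨?_, ?_⟩
    · exact (Complex.continuous_ofReal.tendsto' 0 0 (by simp)).mono_left nhdsWithin_le_nhds
    · filter_upwards [self_mem_nhdsWithin] with x hx
      simpa using hx
  exact htend.frequently hreal

lemma differentiable_det {ι : Type*} [Fintype ι] [DecidableEq ι] {M : ℂ → Matrix ι ι ℂ}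
    (h : ∀ i j, Differentiable ℂ fun z => M z i j) : Differentiable ℂ fun z => (M z).det := by
  simp only [Matrix.det_apply]
  exact Differentiable.fun_sum fun σ _ =>
    (Differentiable.fun_finsetProd fun i _ => h _ _).const_smul _

lemma differentiable_eval_charpoly_triMat (V : ZMod q1 × ZMod q2 → ℂ) (μ : ℂ) {f g : ℂ → ℂ}
    (hf : Differentiable ℂ f) (hg : Differentiable ℂ g) :
    Differentiable ℂ fun k =>
      (triMat q1 q2 V (Complex.exp (f k)) (Complex.exp (g k))).charpoly.eval μ := by
  simp only [Matrix.eval_charpoly]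
  refine differentiable_det fun i j => ?_
  simp only [Matrix.sub_apply, triMat, ← Complex.exp_neg]
  have hite : ∀ (p : Prop) [Decidable p] (u v : ℂ → ℂ), Differentiable ℂ u → Differentiable ℂ v →
      Differentiable ℂ fun z => if p then u z else v z := by
    intro p _ u v hu hv
    split_ifs <;> assumption
  refine (differentiable_const _).sub ?_
  repeat' first
    | refine Differentiable.fun_add ?_ ?_
    | refine hite _ _ _ ?_ ?_
    | fun_prop

/-- Isospectrality extends from the real torus to all nonzero complex multipliers. -/
lemma TriFloquetIso.charpoly_eval_eq {V Y : ZMod q1 × ZMod q2 → ℂ} (h : TriFloquetIso q1 q2 V Y)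
    {z1 z2 : ℂ} (h1 : z1 ≠ 0) (h2 : z2 ≠ 0) (μ : ℂ) :
    (triMat q1 q2 V z1 z2).charpoly.eval μ = (triMat q1 q2 Y z1 z2).charpoly.eval μ := by
  have hpi : (2 * Real.pi * Complex.I : ℂ) ≠ 0 := Complex.two_pi_I_ne_zero
  have surj : ∀ z : ℂ, z ≠ 0 → ∃ k : ℂ, Complex.exp (2 * Real.pi * Complex.I * k) = z := by
    intro z hz
    refine ⟨Complex.log z / (2 * Real.pi * Complex.I), ?_⟩
    rw [mul_div_cancel₀ _ hpi, Complex.exp_log hz]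
  obtain ⟨k1, rfl⟩ := surj z1 h1
  obtain ⟨k2, rfl⟩ := surj z2 h2
  have hdiff : Differentiable ℂ fun k : ℂ => 2 * Real.pi * Complex.I * k := by fun_prop
  have hreal : ∀ x : ℝ, _ := fun x => congrFun (eq_of_differentiable_of_eq_ofReal
    (differentiable_eval_charpoly_triMat V μ
      (differentiable_const (2 * Real.pi * Complex.I * (x : ℂ))) hdiff)
    (differentiable_eval_charpoly_triMat Y μ
      (differentiable_const (2 * Real.pi * Complex.I * (x : ℂ))) hdiff)
    (fun y => congrArg (Polynomial.eval μ) (h x y))) k2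
  exact congrFun (eq_of_differentiable_of_eq_ofReal
    (differentiable_eval_charpoly_triMat V μ hdiff (differentiable_const _))
    (differentiable_eval_charpoly_triMat Y μ hdiff (differentiable_const _)) hreal) k1

lemma triMat_eq_add_diagonal (V : ZMod q1 × ZMod q2 → ℂ) (z1 z2 : ℂ) :
    triMat q1 q2 V z1 z2 = triMat q1 q2 0 z1 z2 + diagonal V := by
  ext n m
  by_cases h : n = m
  · subst h; simp [triMat]
  · simp [triMat, h, Ne.symm h]

lemma TriFloquetIso.coeffs_zero_eq {V Y : ZMod q1 × ZMod q2 → ℂ} (h : TriFloquetIso q1 q2 V Y) :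
    coeffs V 0 = coeffs Y 0 := by
  have htr := congrArg (fun p => -p.coeff (Fintype.card (ZMod q1 × ZMod q2) - 1)) (h 0 0)
  simp only [← Matrix.trace_eq_neg_charpoly_coeff] at htr
  rw [triMat_eq_add_diagonal V, triMat_eq_add_diagonal Y, trace_add, trace_add, trace_diagonal,
    trace_diagonal] at htr
  simp only [coeffs, neg_zero, chi_zero_left, mul_one, add_left_cancel htr]

end Extension

section Arrowhead

variable {ι : Type*} [Fintype ι] [DecidableEq ι]

/-- The determinant of an arrowhead matrix with a vanishing corner entry. -/
lemma det_arrowhead (B : Matrix ι ι ℂ) (i₀ : ι) (hB : B i₀ i₀ = 0) {δ : ι → ℂ}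
    (hδ₀ : δ i₀ = 0) (hδ : ∀ i, i ≠ i₀ → δ i ≠ 0) :
    (diagonal δ - Matrix.of fun i j => if i = i₀ ∨ j = i₀ then B i j else 0).det
      = -((∏ i : {i // ¬ i = i₀}, δ i) *
          ∑ i : {i // ¬ i = i₀}, B i₀ i * B i i₀ / δ i) := by
  have hD : toBlock (diagonal δ - Matrix.of fun i j => if i = i₀ ∨ j = i₀ then B i j else 0)
      (fun i => ¬ i = i₀) (fun i => ¬ i = i₀)
      = diagonal (fun i : {i // ¬ i = i₀} => δ i) := by
    ext i j
    simp [toBlock_apply, diagonal_apply, i.2, j.2, Subtype.ext_iff]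
  let inv : Invertible (diagonal (fun i : {i // ¬ i = i₀} => δ i)) :=
    ⟨diagonal (fun i : {i // ¬ i = i₀} => (δ i)⁻¹),
      by
        rw [diagonal_mul_diagonal, ← diagonal_one]
        exact congrArg _ (funext fun i => inv_mul_cancel₀ (hδ i i.2)),
      by
        rw [diagonal_mul_diagonal, ← diagonal_one]
        exact congrArg _ (funext fun i => mul_inv_cancel₀ (hδ i i.2))⟩
  have hinv : ⅟(diagonal (fun i : {i // ¬ i = i₀} => δ i))
      = diagonal (fun i : {i // ¬ i = i₀} => (δ i)⁻¹) := rfl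
  let _ : Fintype {i // i = i₀} := Subtype.fintype _
  rw [det_toBlock _ (fun i => i = i₀), hD, det_fromBlocks₂₂, det_diagonal, hinv, ← mul_neg]
  congr 1
  rw [det_eq_elem_of_subsingleton _ ⟨i₀, rfl⟩, Matrix.sub_apply, mul_apply]
  simp only [mul_diagonal, toBlock_apply, Matrix.sub_apply, of_apply, diagonal_apply_eq, hδ₀, hB,
    ← Finset.sum_neg_distrib]
  simp only [true_or, or_true, if_true, sub_zero, zero_sub, ← Finset.sum_neg_distrib]
  refine Finset.sum_congr rfl fun i _ => ?_
  rw [diagonal_apply_ne _ i.2, diagonal_apply_ne _ (Ne.symm i.2)]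
  ring

lemma tendsto_ofReal_inv_atTop_zero : Tendsto (fun t : ℝ => (t : ℂ)⁻¹) atTop (𝓝 0) := by
  have := Complex.continuous_ofReal.tendsto' 0 0 (by simp) |>.comp tendsto_inv_atTop_zero
  simpa [Function.comp_def] using this

lemma tendsto_det_scaled (B : Matrix ι ι ℂ) (i₀ : ι) (hB : ∀ i, B i i = 0) {a : ℝ → ι → ℂ}
    {δ : ι → ℂ} (ha₀ : ∀ t, a t i₀ = 0)
    (ha : ∀ i, Tendsto (fun t : ℝ => (t : ℂ)⁻¹ * a t i) atTop (𝓝 (δ i))) :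
    Tendsto (fun t : ℝ => (∏ i : ι, if i = i₀ then (t : ℂ) else 1) *
        ((∏ i : ι, if i = i₀ then (1 : ℂ) else (t : ℂ)⁻¹) * (diagonal (a t) - B).det)) atTop
      (𝓝 (diagonal δ - Matrix.of fun i j => if i = i₀ ∨ j = i₀ then B i j else 0).det) := by
  have hinv := tendsto_ofReal_inv_atTop_zero
  have hδ₀ : δ i₀ = 0 := tendsto_nhds_unique (ha i₀) (by simp [ha₀])
  have hscale : ∀ t : ℝ, (∏ i : ι, if i = i₀ then (t : ℂ) else 1) *
      ((∏ i : ι, if i = i₀ then (1 : ℂ) else (t : ℂ)⁻¹) * (diagonal (a t) - B).det)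
      = (Matrix.of fun i j => (if j = i₀ then (t : ℂ) else 1) *
        ((if i = i₀ then (1 : ℂ) else (t : ℂ)⁻¹) * (diagonal (a t) - B) i j)).det := by
    intro t
    rw [← det_mul_column, ← det_mul_row]
    rfl
  simp only [hscale]
  refine (Continuous.tendsto (f := Matrix.det) (by fun_prop) _).comp ?_
  refine tendsto_pi_nhds.2 fun i => tendsto_pi_nhds.2 fun j => ?_
  by_cases hi : i = i₀ <;> by_cases hj : j = i₀
  · subst hi; subst hj
    simp [hB, hδ₀, ha₀]
  · subst hi
    simp [hj, diagonal_apply_ne _ (Ne.symm hj)]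
  · subst hj
    simp only [of_apply, hi, if_true, if_false, Matrix.sub_apply, diagonal_apply_ne _ hi, or_true]
    refine tendsto_const_nhds.congr' ?_
    filter_upwards [eventually_gt_atTop 0] with t ht
    have : (t : ℂ) ≠ 0 := by exact_mod_cast ht.ne'
    field_simp
  · by_cases hij : i = j
    · subst hij
      simpa [hi, hB] using ha i
    · simpa [hi, hj, diagonal_apply_ne _ hij] using hinv.mul_const (-B i j)

/-- Second order perturbation theory: the determinants of `diagonal (a t) - B` determine the
second order energy shift of the site `i₀`. -/
lemma sum_div_eq_of_det_eq {B C : Matrix ι ι ℂ} (i₀ : ι) (hB : ∀ i, B i i = 0)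
    (hC : ∀ i, C i i = 0) {a : ℝ → ι → ℂ} {δ : ι → ℂ} (ha₀ : ∀ t, a t i₀ = 0)
    (ha : ∀ i, Tendsto (fun t : ℝ => (t : ℂ)⁻¹ * a t i) atTop (𝓝 (δ i)))
    (hδ : ∀ i, i ≠ i₀ → δ i ≠ 0)
    (hdet : ∀ t : ℝ, 0 < t → (diagonal (a t) - B).det = (diagonal (a t) - C).det) :
    ∑ i : {i // ¬ i = i₀}, B i₀ i * B i i₀ / δ i
      = ∑ i : {i // ¬ i = i₀}, C i₀ i * C i i₀ / δ i := by
  have hδ₀ : δ i₀ = 0 := tendsto_nhds_unique (ha i₀) (by simp [ha₀])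
  have hlim := tendsto_nhds_unique ((tendsto_det_scaled B i₀ hB ha₀ ha).congr' (by
    filter_upwards [eventually_gt_atTop 0] with t ht
    rw [hdet t ht])) (tendsto_det_scaled C i₀ hC ha₀ ha)
  rw [det_arrowhead B i₀ (hB _) hδ₀ hδ, det_arrowhead C i₀ (hC _) hδ₀ hδ, neg_inj] at hlim
  exact mul_left_cancel₀ (Finset.prod_ne_zero_iff.2 fun (i : {i // ¬ i = i₀}) _ => hδ i i.2) hlim

end Arrowhead

section EnergyShift

variable {q1 q2 : ℕ} [NeZero q1] [NeZero q2]

/-- The leading part of `symb (t x₁) (t x₂) 0 - symb (t x₁) (t x₂) n` as `t → ∞`. -/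
def gap (x1 x2 : ℝ) (n : ZMod q1 × ZMod q2) : ℂ :=
  (1 - ZMod.stdAddChar n.1) * x1 + (1 - ZMod.stdAddChar n.2) * x2

lemma re_stdAddChar_lt_one {q : ℕ} [NeZero q] {a : ZMod q} (ha : a ≠ 0) :
    (ZMod.stdAddChar a : ℂ).re < 1 := by
  have hnorm : ‖(ZMod.stdAddChar a : ℂ)‖ = 1 := by
    rw [ZMod.stdAddChar_apply, Circle.norm_coe]
  have hle := Complex.re_le_norm (ZMod.stdAddChar a)
  refine lt_of_le_of_ne (hle.trans_eq hnorm) fun hre => ha ?_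
  have him : (ZMod.stdAddChar a : ℂ).im = 0 := by
    have := Complex.sq_norm_sub_sq_re (ZMod.stdAddChar a)
    rw [hnorm, hre] at this
    nlinarith
  refine ZMod.injective_stdAddChar ?_
  rw [AddChar.map_zero_eq_one]
  exact Complex.ext (by simpa using hre) (by simpa using him)

lemma re_stdAddChar_le_one {q : ℕ} [NeZero q] (a : ZMod q) :
    (ZMod.stdAddChar a : ℂ).re ≤ 1 := by
  by_cases ha : a = 0
  · simp [ha]
  · exact (re_stdAddChar_lt_one ha).le

lemma gap_zero (x1 x2 : ℝ) : gap x1 x2 (0 : ZMod q1 × ZMod q2) = 0 := by simp [gap]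

lemma gap_re_pos {x1 x2 : ℝ} (h1 : 0 < x1) (h2 : 0 < x2) {n : ZMod q1 × ZMod q2} (hn : n ≠ 0) :
    0 < (gap x1 x2 n).re := by
  have hre : (gap x1 x2 n).re = (1 - (ZMod.stdAddChar n.1 : ℂ).re) * x1
      + (1 - (ZMod.stdAddChar n.2 : ℂ).re) * x2 := by simp [gap]
  have l1 := re_stdAddChar_le_one n.1
  have l2 := re_stdAddChar_le_one n.2
  rw [hre]
  by_cases hn1 : n.1 = 0
  · have hn2 : n.2 ≠ 0 := fun h => hn (Prod.ext hn1 h)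
    have := re_stdAddChar_lt_one hn2
    exact add_pos_of_nonneg_of_pos (mul_nonneg (by linarith) h1.le) (mul_pos (by linarith) h2)
  · have := re_stdAddChar_lt_one hn1
    exact add_pos_of_pos_of_nonneg (mul_pos (by linarith) h1) (mul_nonneg (by linarith) h2.le)

lemma gap_ne_zero {x1 x2 : ℝ} (h1 : 0 < x1) (h2 : 0 < x2) {n : ZMod q1 × ZMod q2} (hn : n ≠ 0) :
    gap x1 x2 n ≠ 0 := fun h => by
  have := gap_re_pos h1 h2 hn
  simp [h] at this

lemma tendsto_symb {x1 x2 : ℝ} (h1 : 0 < x1) (h2 : 0 < x2) (n : ZMod q1 × ZMod q2) :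
    Tendsto (fun t : ℝ => (t : ℂ)⁻¹ * symb (t * x1 : ℂ) (t * x2) n) atTop
      (𝓝 (ZMod.stdAddChar n.1 * x1 + ZMod.stdAddChar n.2 * x2)) := by
  have hinv := tendsto_ofReal_inv_atTop_zero
  have e1 := stdAddChar_ne_zero n.1
  have e2 := stdAddChar_ne_zero n.2
  have c1 : (x1 : ℂ) ≠ 0 := by exact_mod_cast h1.ne'
  have c2 : (x2 : ℂ) ≠ 0 := by exact_mod_cast h2.ne'
  set y1 : ℂ := ZMod.stdAddChar n.1 * x1 with hy1
  set y2 : ℂ := ZMod.stdAddChar n.2 * x2 with hy2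
  have hlim : Tendsto (fun t : ℝ => y1 + y2 + (t : ℂ)⁻¹ * (y1 * y2⁻¹ + y1⁻¹ * y2)
      + (t : ℂ)⁻¹ * (t : ℂ)⁻¹ * (y1⁻¹ + y2⁻¹)) atTop (𝓝 (y1 + y2)) := by
    have := ((tendsto_const_nhds (x := y1 + y2)).add
      (hinv.mul_const (y1 * y2⁻¹ + y1⁻¹ * y2))).add ((hinv.mul hinv).mul_const (y1⁻¹ + y2⁻¹))
    simpa using this
  refine hlim.congr' ?_
  filter_upwards [eventually_gt_atTop 0] with t ht
  have ht' : (t : ℂ) ≠ 0 := by exact_mod_cast ht.ne'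
  have s1 : ZMod.stdAddChar n.1 * ((t : ℂ) * x1) = t * y1 := by rw [hy1]; ring
  have s2 : ZMod.stdAddChar n.2 * ((t : ℂ) * x2) = t * y2 := by rw [hy2]; ring
  have hy1' : y1 ≠ 0 := mul_ne_zero e1 c1
  have hy2' : y2 ≠ 0 := mul_ne_zero e2 c2
  rw [symb, s1, s2]
  field_simp
  ring

/-- The off-diagonal part of `coeffMat V`. -/
def offCoeffMat (V : ZMod q1 × ZMod q2 → ℂ) :
    Matrix (ZMod q1 × ZMod q2) (ZMod q1 × ZMod q2) ℂ :=
  coeffMat V - diagonal fun _ => coeffs V 0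

lemma offCoeffMat_apply_self (V : ZMod q1 × ZMod q2 → ℂ) (n : ZMod q1 × ZMod q2) :
    offCoeffMat V n n = 0 := by
  simp [offCoeffMat, coeffMat]

lemma offCoeffMat_apply_ne (V : ZMod q1 × ZMod q2 → ℂ) {m n : ZMod q1 × ZMod q2} (h : m ≠ n) :
    offCoeffMat V m n = coeffs V (m - n) := by
  simp [offCoeffMat, coeffMat, h]

lemma TriFloquetIso.sum_div_gap_eq {V Y : ZMod q1 × ZMod q2 → ℂ} (h : TriFloquetIso q1 q2 V Y)
    {x1 x2 : ℝ} (h1 : 0 < x1) (h2 : 0 < x2) :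
    ∑ n, coeffs V n * coeffs V (-n) / gap x1 x2 n
      = ∑ n, coeffs Y n * coeffs Y (-n) / gap x1 x2 n := by
  have hsplit : ∀ U : ZMod q1 × ZMod q2 → ℂ,
      ∑ n, coeffs U n * coeffs U (-n) / gap x1 x2 n
        = ∑ n : {n : ZMod q1 × ZMod q2 // ¬ n = 0},
          offCoeffMat U 0 n.1 *
            offCoeffMat U n.1 0 / gap x1 x2 n.1 := by
    intro U
    rw [← Fintype.sum_subtype_add_sum_subtype (fun n => n = 0), Finset.sum_eq_zero, zero_add]
    · refine Finset.sum_congr rfl fun n _ => ?_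
      rw [offCoeffMat_apply_ne U n.2, offCoeffMat_apply_ne U (Ne.symm n.2), zero_sub, sub_zero,
        mul_comm (coeffs U n)]
    · rintro ⟨n, rfl⟩ -
      simp [gap_zero]
  rw [hsplit, hsplit]
  refine sum_div_eq_of_det_eq 0 (offCoeffMat_apply_self V) (offCoeffMat_apply_self Y)
    (a := fun t n => symb (t * x1 : ℂ) (t * x2) 0 - symb (t * x1 : ℂ) (t * x2) n)
    (fun t => sub_self _) (fun i => ?_) (fun i hi => gap_ne_zero h1 h2 hi) fun t ht => ?_
  · have := (tendsto_symb h1 h2 (0 : ZMod q1 × ZMod q2)).sub (tendsto_symb h1 h2 i)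
    simp only [← mul_sub] at this
    convert this using 2
    simp [gap]
    ring
  · have w1 : (t * x1 : ℂ) ≠ 0 := by exact_mod_cast (mul_pos ht h1).ne'
    have w2 : (t * x2 : ℂ) ≠ 0 := by exact_mod_cast (mul_pos ht h2).ne'
    have key := h.charpoly_eval_eq (pow_ne_zero q1 w1) (pow_ne_zero q2 w2)
      (symb (t * x1 : ℂ) (t * x2) (0 : ZMod q1 × ZMod q2) + coeffs V 0)
    rw [eval_charpoly_triMat V w1 w2, eval_charpoly_triMat Y w1 w2] at key
    have hmat : ∀ (U : ZMod q1 × ZMod q2 → ℂ) (s : ℂ) (d : ZMod q1 × ZMod q2 → ℂ),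
        scalar _ (s + coeffs U 0) - (diagonal d + coeffMat U)
          = diagonal (fun n => s - d n) - offCoeffMat U := by
      intro U s d
      ext i j
      by_cases hij : i = j
      · subst hij
        simp only [offCoeffMat, scalar_apply, Matrix.sub_apply, Matrix.add_apply,
          diagonal_apply_eq]
        ring
      · simp [offCoeffMat, hij]
    rw [hmat, h.coeffs_zero_eq, hmat] at key
    exact key

/-- A function with vanishing weighted sums against all `1 / gap` that is nonnegative off the
axes vanishes off the axes. -/
lemma eq_zero_of_sum_div_gap_eq_zero {f : ZMod q1 × ZMod q2 → ℝ}
    (hsum : ∀ x1 x2 : ℝ, 0 < x1 → 0 < x2 → ∑ n, (f n : ℂ) / gap x1 x2 n = 0)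
    (hf : ∀ n : ZMod q1 × ZMod q2, n.1 ≠ 0 → n.2 ≠ 0 → 0 ≤ f n)
    {n : ZMod q1 × ZMod q2} (h1 : n.1 ≠ 0) (h2 : n.2 ≠ 0) : f n = 0 := by
  have hne : ∀ {q : ℕ} [NeZero q] {a : ZMod q}, a ≠ 0 → (1 - ZMod.stdAddChar a : ℂ) ≠ 0 := by
    intro q _ a ha h0
    have := re_stdAddChar_lt_one ha
    rw [← sub_eq_zero.1 h0] at this
    simp at this
  have hx : Tendsto (fun x : ℝ => (x : ℂ)) (𝓝[>] 0) (𝓝 0) :=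
    (Complex.continuous_ofReal.tendsto' 0 0 (by simp)).mono_left nhdsWithin_le_nhds
  have axis1 : ∑ m : ZMod q1 × ZMod q2,
      (if m.2 = 0 then (f m : ℂ) / (1 - ZMod.stdAddChar m.1) else 0) = 0 := by
    refine tendsto_nhds_unique (f := fun x : ℝ => ∑ m, (x : ℂ) * ((f m : ℂ) / gap x 1 m))
      (l := 𝓝[>] (0 : ℝ)) (tendsto_finsetSum _ fun m _ => ?_) ?_
    · split_ifs with hm
      · refine tendsto_const_nhds.congr' ?_
        filter_upwards [self_mem_nhdsWithin] with x hx0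
        have : (x : ℂ) ≠ 0 := by exact_mod_cast (Set.mem_Ioi.1 hx0).ne'
        simp only [gap, hm, AddChar.map_zero_eq_one, sub_self, zero_mul, add_zero]
        rw [mul_div_assoc', mul_comm (x : ℂ), mul_div_mul_right _ _ this]
      · have hg : Tendsto (fun x : ℝ => gap x 1 m) (𝓝[>] 0) (𝓝 (1 - ZMod.stdAddChar m.2)) := by
          simpa [gap] using (hx.const_mul (1 - ZMod.stdAddChar m.1)).add_const
            (1 - ZMod.stdAddChar m.2)
        simpa using hx.mul ((tendsto_const_nhds (x := (f m : ℂ))).div hg (hne hm))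
    · refine tendsto_const_nhds.congr' ?_
      filter_upwards [self_mem_nhdsWithin] with x hx0
      rw [← Finset.mul_sum, hsum x 1 hx0 one_pos, mul_zero]
  have axis2 : ∑ m : ZMod q1 × ZMod q2,
      (if m.1 = 0 then (f m : ℂ) / (1 - ZMod.stdAddChar m.2) else 0) = 0 := by
    refine tendsto_nhds_unique (f := fun x : ℝ => ∑ m, (x : ℂ) * ((f m : ℂ) / gap 1 x m))
      (l := 𝓝[>] (0 : ℝ)) (tendsto_finsetSum _ fun m _ => ?_) ?_
    · split_ifs with hm
      · refine tendsto_const_nhds.congr' ?_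
        filter_upwards [self_mem_nhdsWithin] with x hx0
        have : (x : ℂ) ≠ 0 := by exact_mod_cast (Set.mem_Ioi.1 hx0).ne'
        simp only [gap, hm, AddChar.map_zero_eq_one, sub_self, zero_mul, zero_add]
        rw [mul_div_assoc', mul_comm (x : ℂ), mul_div_mul_right _ _ this]
      · have hg : Tendsto (fun x : ℝ => gap 1 x m) (𝓝[>] 0) (𝓝 (1 - ZMod.stdAddChar m.1)) := by
          simpa [gap] using (hx.const_mul (1 - ZMod.stdAddChar m.2)).const_add
            (1 - ZMod.stdAddChar m.1)
        simpa using hx.mul ((tendsto_const_nhds (x := (f m : ℂ))).div hg (hne hm))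
    · refine tendsto_const_nhds.congr' ?_
      filter_upwards [self_mem_nhdsWithin] with x hx0
      rw [← Finset.mul_sum, hsum 1 x one_pos hx0, mul_zero]
  have hoff : ∑ m : ZMod q1 × ZMod q2,
      (if m.1 ≠ 0 ∧ m.2 ≠ 0 then (f m : ℂ) / gap 1 1 m else 0) = 0 := by
    have hall := hsum 1 1 one_pos one_pos
    have hdecomp : ∀ m : ZMod q1 × ZMod q2, (f m : ℂ) / gap 1 1 m
        = (if m.2 = 0 then (f m : ℂ) / (1 - ZMod.stdAddChar m.1) else 0)
          + (if m.1 = 0 then (f m : ℂ) / (1 - ZMod.stdAddChar m.2) else 0)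
          + (if m.1 ≠ 0 ∧ m.2 ≠ 0 then (f m : ℂ) / gap 1 1 m else 0) := by
      intro m
      by_cases hm1 : m.1 = 0 <;> by_cases hm2 : m.2 = 0 <;> simp [hm1, hm2, gap]
    rw [Finset.sum_congr rfl fun m _ => hdecomp m, Finset.sum_add_distrib,
      Finset.sum_add_distrib, axis1, axis2, zero_add, zero_add] at hall
    exact hall
  have hre := congrArg Complex.re hoff
  rw [Complex.re_sum, Complex.zero_re] at hre
  have hterm : ∀ m : ZMod q1 × ZMod q2, m.1 ≠ 0 → m.2 ≠ 0 →
      0 < ((gap 1 1 m)⁻¹).re := by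
    intro m hm1 _
    have hm : m ≠ 0 := fun h => hm1 (by simp [h])
    rw [Complex.inv_re]
    exact div_pos (gap_re_pos one_pos one_pos hm)
      (Complex.normSq_pos.2 (gap_ne_zero one_pos one_pos hm))
  have hval : ∀ m : ZMod q1 × ZMod q2, ((f m : ℂ) / gap 1 1 m).re
      = f m * ((gap 1 1 m)⁻¹).re := by
    intro m
    rw [div_eq_mul_inv, Complex.re_ofReal_mul]
  have hzero := (Finset.sum_eq_zero_iff_of_nonneg fun m _ => by
    split_ifs with hm
    · rw [hval]
      exact mul_nonneg (hf m hm.1 hm.2) (hterm m hm.1 hm.2).le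
    · simp).1 hre n (Finset.mem_univ n)
  rw [if_pos ⟨h1, h2⟩, hval] at hzero
  exact (mul_eq_zero.1 hzero).resolve_right (hterm n h1 h2).ne'

end EnergyShift

/-- If real-valued potentials `V, Y` on the triangular lattice are Tri-Floquet
isospectral and `Y` is separable, then `V` is separable. -/
theorem stmt13 (q1 q2 : ℕ) [NeZero q1] [NeZero q2]
    (V Y : ZMod q1 × ZMod q2 → ℝ)
    (hiso : TriFloquetIso q1 q2 (fun n => (V n : ℂ)) (fun n => (Y n : ℂ)))
    (hYsep : TriSeparable q1 q2 (fun n => (Y n : ℂ))) :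
    TriSeparable q1 q2 (fun n => (V n : ℂ)) := by
  have hY : ∀ n : ZMod q1 × ZMod q2, n.1 ≠ 0 → n.2 ≠ 0 →
      Complex.normSq (coeffs (fun n => (Y n : ℂ)) n) = 0 := fun n h1 h2 => by
    rw [hYsep.coeffs_eq_zero h1 h2, map_zero]
  refine triSeparable_of_coeffs_eq_zero fun n h1 h2 => Complex.normSq_eq_zero.1 ?_
  have hzero := eq_zero_of_sum_div_gap_eq_zero
    (f := fun n => Complex.normSq (coeffs (fun n => (V n : ℂ)) n)
      - Complex.normSq (coeffs (fun n => (Y n : ℂ)) n))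
    (fun x1 x2 hx1 hx2 => ?_) (fun m hm1 hm2 => ?_) h1 h2
  · rwa [hY n h1 h2, sub_zero] at hzero
  · have hsum := hiso.sum_div_gap_eq hx1 hx2
    simp only [coeffs_mul_coeffs_neg] at hsum
    simp only [Complex.ofReal_sub, sub_div, Finset.sum_sub_distrib, hsum, sub_self]
  · rw [hY m hm1 hm2, sub_zero]
    exact Complex.normSq_nonneg _

end TriDPSO
end
end

section
/- Let V, Y : W → ℝ be real-valued Γ-periodic potentials on ℤ² that are Tri-Floquet isospectral (i.e., Floquet isospectral for the triangular-lattice Laplacian). Then: (i) [V] = [Y]; (ii) Σ_{l∈W} |V̂(l)|² = Σ_{l∈W} |Ŷ(l)|²; (iii) Σ_{l₁∈ℤ/q₁ℤ} |V̂(l₁,0)|² = Σ_{l₁∈ℤ/q₁ℤ} |Ŷ(l₁,0)|²; and (iv) Σ_{l₂∈ℤ/q₂ℤ} |V̂(0,l₂)|² = Σ_{l₂∈ℤ/q₂ℤ} |Ŷ(0,l₂)|². -/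
open scoped BigOperators

noncomputable section

namespace TriDPSO

section Charpoly

variable {ι : Type*} [Fintype ι] [DecidableEq ι]

/-- The determinant of a polynomial in a matrix is determined by the characteristic polynomial. -/
theorem det_aeval_eq_of_charpoly_eq {A B : Matrix ι ι ℂ} (h : A.charpoly = B.charpoly)
    (p : Polynomial ℂ) : (Polynomial.aeval A p).det = (Polynomial.aeval B p).det := by
  have key : ∀ (M : Matrix ι ι ℂ) (a : ℂ),
      (Polynomial.aeval M (Polynomial.X - Polynomial.C a)).det
        = (-1) ^ Fintype.card ι * M.charpoly.eval a := by
    intro M a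
    rw [Matrix.eval_charpoly, ← Matrix.det_neg, map_sub, Polynomial.aeval_X, Polynomial.aeval_C,
      neg_sub, Matrix.algebraMap_eq_diagonal]
    rfl
  let φ (M : Matrix ι ι ℂ) : Polynomial ℂ →* ℂ :=
    Matrix.detMonoidHom.comp (Polynomial.aeval M).toRingHom.toMonoidHom
  have hφ : φ A p = φ B p := by
    rw [(IsAlgClosed.splits p).eq_prod_roots, map_mul, map_mul, map_multiset_prod,
      map_multiset_prod, Multiset.map_map, Multiset.map_map]
    congr 1
    · simp [φ]
    · congr 1
      refine Multiset.map_congr rfl fun a _ => ?_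
      change (Polynomial.aeval A (Polynomial.X - Polynomial.C a)).det
        = (Polynomial.aeval B (Polynomial.X - Polynomial.C a)).det
      rw [key, key, h]
  exact hφ

theorem trace_pow_eq_of_charpoly_eq {A B : Matrix ι ι ℂ} (h : A.charpoly = B.charpoly) (n : ℕ) :
    (A ^ n).trace = (B ^ n).trace := by
  have hc : (A ^ n).charpoly = (B ^ n).charpoly := by
    refine Polynomial.funext fun x => ?_
    have := det_aeval_eq_of_charpoly_eq h (Polynomial.C x - Polynomial.X ^ n)
    simpa [Matrix.eval_charpoly, Matrix.algebraMap_eq_diagonal, Matrix.scalar_apply,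
      Pi.algebraMap_def] using this
  rw [Matrix.trace_eq_sum_roots_charpoly, Matrix.trace_eq_sum_roots_charpoly, hc]

end Charpoly

section PowerExpansion

variable {A : Type*} [Ring A]

/-- The coefficient of `u` in `(K + u V) ^ n`. -/
def firstOrder (K V : A) : ℕ → A
  | 0 => 0
  | n + 1 => firstOrder K V n * K + K ^ n * V

/-- The coefficient of `u ^ 2` in `(K + u V) ^ n`. -/
def secondOrder (K V : A) : ℕ → A
  | 0 => 0
  | n + 1 => secondOrder K V n * K + firstOrder K V n * V

theorem firstOrder_eq_sum (K V : A) (n : ℕ) :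
    firstOrder K V n = ∑ i ∈ Finset.range n, K ^ i * V * K ^ (n - 1 - i) := by
  induction n with
  | zero => simp [firstOrder]
  | succ n ih =>
    rw [firstOrder, ih, Finset.sum_range_succ, Finset.sum_mul]
    congr 1
    · refine Finset.sum_congr rfl fun i hi => ?_
      have : n + 1 - 1 - i = (n - 1 - i) + 1 := by
        have := Finset.mem_range.mp hi
        omega
      rw [this, pow_succ, mul_assoc _ _ K]
    · simp

theorem exists_add_smul_pow_eq {R : Type*} [CommRing R] [Algebra R A] (K V : A) (u : R) (n : ℕ) :
    ∃ Z : A, (K + u • V) ^ n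
      = K ^ n + u • firstOrder K V n + u ^ 2 • secondOrder K V n + u ^ 3 • Z := by
  induction n with
  | zero => exact ⟨0, by simp [firstOrder, secondOrder]⟩
  | succ n ih =>
    obtain ⟨Z, hZ⟩ := ih
    refine ⟨Z * K + secondOrder K V n * V + u • (Z * V), ?_⟩
    rw [pow_succ, hZ, firstOrder, secondOrder]
    simp only [add_mul, mul_add, smul_add, smul_mul_assoc, mul_smul_comm, smul_smul, pow_succ]
    module

theorem map_firstOrder {B : Type*} [Ring B] (f : A →+* B) (K V : A) (n : ℕ) :
    f (firstOrder K V n) = firstOrder (f K) (f V) n := by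
  induction n with
  | zero => simp [firstOrder]
  | succ n ih => simp [firstOrder, ih]

theorem map_secondOrder {B : Type*} [Ring B] (f : A →+* B) (K V : A) (n : ℕ) :
    f (secondOrder K V n) = secondOrder (f K) (f V) n := by
  induction n with
  | zero => simp [secondOrder]
  | succ n ih => simp [secondOrder, ih, map_firstOrder]

end PowerExpansion

theorem two_mul_sum_range_sum_range (C : ℕ → ℂ) (m : ℕ) (hC : ∀ b ≤ m, C (m - b) = C b) :
    2 * ∑ j ∈ Finset.range (m + 2), ∑ b ∈ Finset.range j, C b
      = (m + 2) * ∑ b ∈ Finset.range (m + 1), C b := by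
  have hpair : ∀ j ∈ Finset.range (m + 2), ∑ b ∈ Finset.range j, C b
      + ∑ b ∈ Finset.range (m + 2 - 1 - j), C b = ∑ b ∈ Finset.range (m + 1), C b := by
    intro j hj
    have hj' : j ≤ m + 1 := by
      have := Finset.mem_range.mp hj
      omega
    rw [← Finset.sum_range_add_sum_Ico C hj', Finset.sum_Ico_eq_sum_range]
    congr 1
    rw [← Finset.sum_range_reflect]
    refine Finset.sum_congr (by simp) fun b hb => ?_
    have hb' := Finset.mem_range.mp hb
    rw [← hC _ (by omega)]
    congr 1
    omega
  rw [two_mul]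
  nth_rewrite 2 [← Finset.sum_range_reflect]
  rw [← Finset.sum_add_distrib, Finset.sum_congr rfl hpair]
  simp

section Autocorrelation

variable {G : Type*} [Fintype G] [AddCommGroup G]

/-- The autocorrelation of `V` at the shift `e`. -/
def autocorr (V : G → ℂ) (e : G) : ℂ := ∑ n, V n * V (n + e)

theorem autocorr_neg (V : G → ℂ) (e : G) : autocorr V (-e) = autocorr V e := by
  unfold autocorr
  rw [← Equiv.sum_comp (Equiv.addRight e) fun n => V n * V (n + -e)]
  simp [mul_comm]

end Autocorrelation

section Circulant

variable {G : Type*} [Fintype G] [DecidableEq G] [AddCommGroup G]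

theorem exists_circulant_pow_eq {R : Type*} [CommRing R] (v : G → R) (n : ℕ) :
    ∃ w : G → R, Matrix.circulant v ^ n = Matrix.circulant w := by
  induction n with
  | zero => exact ⟨Pi.single 0 1, by rw [pow_zero, Matrix.circulant_single_one]⟩
  | succ n ih =>
    obtain ⟨w, hw⟩ := ih
    exact ⟨_, by rw [pow_succ, hw, Matrix.circulant_mul]⟩

theorem trace_circulant_mul_diagonal {R : Type*} [CommRing R] (v V : G → R) :
    (Matrix.circulant v * Matrix.diagonal V).trace = v 0 * ∑ n, V n := by
  simp [Matrix.trace, Matrix.mul_diagonal, Finset.mul_sum]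

theorem trace_firstOrder_circulant_eq {R : Type*} [CommRing R] (v V Y : G → R)
    (h : ∑ n, V n = ∑ n, Y n) (n : ℕ) :
    (firstOrder (Matrix.circulant v) (Matrix.diagonal V) n).trace
      = (firstOrder (Matrix.circulant v) (Matrix.diagonal Y) n).trace := by
  rw [firstOrder_eq_sum, firstOrder_eq_sum, Matrix.trace_sum, Matrix.trace_sum]
  refine Finset.sum_congr rfl fun i _ => ?_
  obtain ⟨w, hw⟩ := exists_circulant_pow_eq v (n - 1 - i + i)
  rw [Matrix.trace_mul_comm, Matrix.trace_mul_comm _ (_ ^ (n - 1 - i)), ← mul_assoc, ← mul_assoc,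
    ← pow_add, hw, trace_circulant_mul_diagonal, trace_circulant_mul_diagonal, h]

/-- The shift matrix with entry `1` at `(n, n + e)`. -/
def shiftMat (e : G) : Matrix G G ℂ := Matrix.circulant fun d => if d = -e then 1 else 0

theorem shiftMat_pow (e : G) (a : ℕ) : shiftMat e ^ a = shiftMat (a • e) := by
  induction a with
  | zero =>
    ext i j
    simp [shiftMat, Matrix.one_apply, sub_eq_zero]
  | succ a ih =>
    ext i j
    rw [pow_succ, ih, Matrix.mul_apply, Finset.sum_eq_single (i + a • e)]
    · simp only [shiftMat, Matrix.circulant_apply]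
      have : i - (i + a • e) = -(a • e) := by abel
      rw [if_pos this, one_mul]
      refine if_congr ?_ rfl rfl
      rw [succ_nsmul]
      constructor <;> intro h
      · have : i - j = (i + a • e - j) - a • e := by abel
        rw [this, h]; abel
      · have : i + a • e - j = (i - j) + a • e := by abel
        rw [this, h]; abel
    · intro b _ hb
      simp only [shiftMat, Matrix.circulant_apply]
      rw [if_neg, zero_mul]
      intro h
      apply hb
      have : b = i - (i - b) := by abel
      rw [this, h]; abel
    · simp

theorem trace_shiftMat_mul_diagonal (V : G → ℂ) (e f : G) (h : e + f = 0) :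
    (shiftMat e * Matrix.diagonal V * (shiftMat f * Matrix.diagonal V)).trace = autocorr V e := by
  obtain rfl : f = -e := (neg_eq_of_add_eq_zero_right h).symm
  unfold Matrix.trace autocorr
  refine Finset.sum_congr rfl fun i _ => ?_
  rw [Matrix.diag_apply, Matrix.mul_apply, Finset.sum_eq_single (i + e)]
  · simp [shiftMat, mul_comm]
  · intro b _ hb
    rw [Matrix.mul_diagonal, shiftMat, Matrix.circulant_apply, if_neg, zero_mul, zero_mul]
    intro h
    apply hb
    have : b = i - (i - b) := by abel
    rw [this, h]; abel
  · simp

theorem trace_secondOrder_mul_shiftMat_pow (V : G → ℂ) (e : G) (m : ℕ) (hm : m • e = 0)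
    (n p : ℕ) (hnp : n + p = m + 2) :
    (secondOrder (shiftMat e) (Matrix.diagonal V) n * shiftMat e ^ p).trace
      = ∑ j ∈ Finset.range n, ∑ b ∈ Finset.range j, autocorr V (b • e) := by
  induction n generalizing p with
  | zero => simp [secondOrder]
  | succ n ih =>
    rw [secondOrder, add_mul, Matrix.trace_add, mul_assoc, ← pow_succ', ih _ (by omega),
      Finset.sum_range_succ]
    congr 1
    rw [Matrix.trace_mul_comm, firstOrder_eq_sum, Finset.sum_mul, Finset.mul_sum,
      Matrix.trace_sum, ← Finset.sum_range_reflect]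
    refine Finset.sum_congr rfl fun i hi => ?_
    have hi' := Finset.mem_range.mp hi
    have hsum : (p + (n - 1 - i)) + i = m := by omega
    have h0 : (p + (n - 1 - i)) • e + i • e = 0 := by rw [← add_nsmul, hsum, hm]
    have hi2 : n - 1 - (n - 1 - i) = i := by omega
    have hassoc : shiftMat e ^ p * (shiftMat e ^ (n - 1 - i) * Matrix.diagonal V
          * shiftMat e ^ (n - 1 - (n - 1 - i)) * Matrix.diagonal V)
        = shiftMat ((p + (n - 1 - i)) • e) * Matrix.diagonal V
          * (shiftMat (i • e) * Matrix.diagonal V) := by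
      rw [hi2, ← shiftMat_pow, ← shiftMat_pow, pow_add]
      simp only [mul_assoc]
    rw [hassoc, trace_shiftMat_mul_diagonal V _ _ h0, eq_neg_of_add_eq_zero_left h0, autocorr_neg]

theorem two_mul_trace_secondOrder_shiftMat (V : G → ℂ) (e : G) (m : ℕ) (hm : m • e = 0) :
    2 * (secondOrder (shiftMat e) (Matrix.diagonal V) (m + 2)).trace
      = (m + 2) * ∑ b ∈ Finset.range (m + 1), autocorr V (b • e) := by
  have h := trace_secondOrder_mul_shiftMat_pow V e m hm (m + 2) 0 rfl
  rw [pow_zero, mul_one] at h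
  rw [h, two_mul_sum_range_sum_range]
  intro b hb
  have : (m - b) • e = -(b • e) := by
    rw [eq_neg_iff_add_eq_zero, ← add_nsmul, Nat.sub_add_cancel hb, hm]
  rw [this, autocorr_neg]

/-- Autocorrelation sums along `e` are determined by traces of powers of a polynomial family of
circulant perturbations whose value at `0` is the shift by `e`. -/
theorem sum_autocorr_eq_of_trace_pow_eq (v : G → Polynomial ℂ) (e : G)
    (hv : ∀ d, (v d).eval 0 = if d = -e then 1 else 0) (V Y : G → ℂ)
    (hVY : ∑ n, V n = ∑ n, Y n) (m : ℕ) (hm : m • e = 0) (S : Set ℂ) (hS : S.Infinite)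
    (htr : ∀ s ∈ S,
      ((Matrix.circulant (fun d => (v d).eval s) + s ^ 2 • Matrix.diagonal V) ^ (m + 2)).trace
      = ((Matrix.circulant (fun d => (v d).eval s) + s ^ 2 • Matrix.diagonal Y) ^ (m + 2)).trace) :
    ∑ b ∈ Finset.range (m + 1), autocorr V (b • e)
      = ∑ b ∈ Finset.range (m + 1), autocorr Y (b • e) := by
  let T (U : G → ℂ) : Matrix G G (Polynomial ℂ) := Matrix.diagonal fun n => Polynomial.C (U n)
  let K : Matrix G G (Polynomial ℂ) := Matrix.circulant v
  have heval : ∀ (s : ℂ) (M : Matrix G G (Polynomial ℂ)),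
      M.trace.eval s = ((Polynomial.evalRingHom s).mapMatrix M).trace := by
    intro s M
    rw [← Polynomial.coe_evalRingHom]
    simp [Matrix.trace]
  have hmapT : ∀ (s : ℂ) (U : G → ℂ),
      (Polynomial.evalRingHom s).mapMatrix (T U) = Matrix.diagonal U := by
    intro s U
    ext i j
    by_cases hij : i = j <;> simp [T, hij]
  have hmapK : ∀ s : ℂ, (Polynomial.evalRingHom s).mapMatrix K
      = Matrix.circulant (fun d => (v d).eval s) := by
    intro s
    ext i j
    simp [K]
  have hmapsmul : ∀ (s : ℂ) (M : Matrix G G (Polynomial ℂ)),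
      (Polynomial.evalRingHom s).mapMatrix ((Polynomial.X ^ 2 : Polynomial ℂ) • M)
        = s ^ 2 • (Polynomial.evalRingHom s).mapMatrix M := by
    intro s M
    ext i j
    simp
  have hpoly : ((K + (Polynomial.X ^ 2 : Polynomial ℂ) • T V) ^ (m + 2)).trace
      = ((K + (Polynomial.X ^ 2 : Polynomial ℂ) • T Y) ^ (m + 2)).trace := by
    refine Polynomial.eq_of_infinite_eval_eq _ _ (hS.mono fun s hs => ?_)
    rw [Set.mem_ofPred_eq, heval, heval, map_pow, map_pow, map_add, map_add, hmapsmul, hmapsmul,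
      hmapT, hmapT, hmapK]
    exact htr s hs
  obtain ⟨ZV, hZV⟩ := exists_add_smul_pow_eq K (T V) (Polynomial.X ^ 2 : Polynomial ℂ) (m + 2)
  obtain ⟨ZY, hZY⟩ := exists_add_smul_pow_eq K (T Y) (Polynomial.X ^ 2 : Polynomial ℂ) (m + 2)
  have hfirst : (firstOrder K (T V) (m + 2)).trace = (firstOrder K (T Y) (m + 2)).trace :=
    trace_firstOrder_circulant_eq v _ _ (by rw [← map_sum, ← map_sum, hVY]) _
  rw [hZV, hZY] at hpoly
  simp only [Matrix.trace_add, Matrix.trace_smul, hfirst, smul_eq_mul] at hpoly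
  have hcancel : (secondOrder K (T V) (m + 2)).trace + Polynomial.X ^ 2 * ZV.trace
      = (secondOrder K (T Y) (m + 2)).trace + Polynomial.X ^ 2 * ZY.trace := by
    have hX : (Polynomial.X ^ 4 : Polynomial ℂ) ≠ 0 := pow_ne_zero _ Polynomial.X_ne_zero
    apply mul_left_cancel₀ hX
    linear_combination hpoly
  have hshift : (Polynomial.evalRingHom 0).mapMatrix K = shiftMat e := by
    rw [hmapK, shiftMat]
    simp only [hv]
  have hzero := congrArg (Polynomial.eval 0) hcancel
  simp only [Polynomial.eval_add, Polynomial.eval_mul, Polynomial.eval_pow, Polynomial.eval_X,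
    heval, map_secondOrder, hmapT, hshift] at hzero
  have hV := two_mul_trace_secondOrder_shiftMat V e m hm
  have hY := two_mul_trace_secondOrder_shiftMat Y e m hm
  have hne : (m + 2 : ℂ) ≠ 0 := by exact_mod_cast (Nat.succ_ne_zero (m + 1))
  apply mul_left_cancel₀ hne
  rw [← hV, ← hY]
  linear_combination 2 * hzero

end Circulant

section Gauge

theorem val_add_one_eq_mod {q : ℕ} [NeZero q] (n : ZMod q) : (n + 1).val = (n.val + 1) % q := by
  have h : n + 1 = ((n.val + 1 : ℕ) : ZMod q) := by simp
  rw [h, ZMod.val_natCast]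

theorem ite_mul_pow_val_add_one {q : ℕ} [NeZero q] (w : ℂ) (n : ZMod q) :
    (if n.val = q - 1 then w ^ q else 1) * w ^ (n + 1).val = w ^ n.val * w := by
  have hq := NeZero.pos q
  have hn := n.val_lt
  rw [val_add_one_eq_mod]
  split_ifs with h
  · have h1 : n.val + 1 = q := by omega
    rw [h1, Nat.mod_self, pow_zero, mul_one, ← pow_succ, h1]
  · rw [Nat.mod_eq_of_lt (by omega), one_mul, pow_succ]

theorem ite_mul_pow_val_sub_one {q : ℕ} [NeZero q] {w : ℂ} (hw : w ≠ 0) (n : ZMod q) :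
    (if n.val = 0 then (w ^ q)⁻¹ else 1) * w ^ (n - 1).val = w ^ n.val * w⁻¹ := by
  obtain ⟨m, rfl⟩ : ∃ m, n = m + 1 := ⟨n - 1, by ring⟩
  have hq := NeZero.pos q
  have hm := m.val_lt
  rw [add_sub_cancel_right, val_add_one_eq_mod]
  by_cases h : m.val + 1 = q
  · rw [h, Nat.mod_self, if_pos rfl]
    have hw' : w ^ q = w ^ m.val * w := by rw [← pow_succ, h]
    rw [hw']
    field_simp
  · rw [Nat.mod_eq_of_lt (by omega), if_neg (by omega), pow_succ]
    field_simp

variable {q1 q2 : ℕ}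

/-- The translation-invariant nearest-neighbour hopping kernel on the triangular lattice, with a
weight for each of the six directions. -/
def hop {R : Type*} [AddMonoid R] (a1 a2 b1 b2 c1 c2 : R) (d : ZMod q1 × ZMod q2) : R :=
  (if d = -(1, 0) then a1 else 0) + (if d = (1, 0) then a2 else 0)
    + (if d = -(0, 1) then b1 else 0) + (if d = (0, 1) then b2 else 0)
    + (if d = -(1, 0) + (0, 1) then c1 else 0) + (if d = (1, 0) - (0, 1) then c2 else 0)

theorem eval_hop (s : ℂ) (a1 a2 b1 b2 c1 c2 : Polynomial ℂ) (d : ZMod q1 × ZMod q2) :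
    (hop a1 a2 b1 b2 c1 c2 d).eval s
      = hop (a1.eval s) (a2.eval s) (b1.eval s) (b2.eval s) (c1.eval s) (c2.eval s) d := by
  have h : ∀ (P : Prop) [Decidable P] (p : Polynomial ℂ),
      (if P then p else 0).eval s = if P then p.eval s else 0 := by
    intro P _ p
    split_ifs <;> simp
  simp only [hop, Polynomial.eval_add, h]

theorem mul_hop (s a1 a2 b1 b2 c1 c2 : ℂ) (d : ZMod q1 × ZMod q2) :
    s * hop a1 a2 b1 b2 c1 c2 d = hop (s * a1) (s * a2) (s * b1) (s * b2) (s * c1) (s * c2) d := by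
  simp only [hop, mul_add, mul_ite, mul_zero]

variable [NeZero q1] [NeZero q2]

/-- Gauging away the boundary phases of the Floquet matrix. -/
theorem triMat_mul_diagonal (V : ZMod q1 × ZMod q2 → ℂ) {w1 w2 : ℂ} (h1 : w1 ≠ 0) (h2 : w2 ≠ 0) :
    triMat q1 q2 V (w1 ^ q1) (w2 ^ q2) * Matrix.diagonal (fun n => w1 ^ n.1.val * w2 ^ n.2.val)
      = Matrix.diagonal (fun n => w1 ^ n.1.val * w2 ^ n.2.val)
        * (Matrix.circulant (hop w1 w1⁻¹ w2 w2⁻¹ (w1 * w2⁻¹) (w1⁻¹ * w2))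
            + Matrix.diagonal V) := by
  ext n n'
  have hite : ∀ (P Q : Prop) [Decidable P] [Decidable Q] (x y a b : ℂ), (P ↔ Q) →
      (P → x * a = b * y) → (if P then x else 0) * a = b * (if Q then y else 0) := by
    intro P Q _ _ x y a b hPQ h
    by_cases hP : P
    · rw [if_pos hP, if_pos (hPQ.mp hP), h hP]
    · rw [if_neg hP, if_neg (fun hQ => hP (hPQ.mpr hQ)), zero_mul, mul_zero]
  have hsub : ∀ a : ZMod q1 × ZMod q2, n' = n + a ↔ n - n' = -a := by
    intro a
    constructor <;> intro h
    · rw [h]; abel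
    · rw [← sub_sub_cancel n n', h]; abel
  have u1 := ite_mul_pow_val_add_one w1 n.1
  have u2 := ite_mul_pow_val_add_one w2 n.2
  have d1 := ite_mul_pow_val_sub_one h1 n.1
  have d2 := ite_mul_pow_val_sub_one h2 n.2
  rw [Matrix.mul_diagonal, Matrix.diagonal_mul, triMat, Matrix.add_apply, Matrix.circulant_apply,
    Matrix.diagonal_apply, hop]
  simp only [add_mul, mul_add]
  congr 1
  congr 1
  congr 1
  congr 1
  congr 1
  congr 1
  · refine hite _ _ _ _ _ _ (hsub _) ?_
    rintro rfl
    simp only [Prod.fst_add, Prod.snd_add, add_zero]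
    linear_combination w2 ^ n.2.val * u1
  · refine hite _ _ _ _ _ _ (by rw [sub_eq_add_neg, hsub, neg_neg]) ?_
    rintro rfl
    simp only [Prod.fst_sub, Prod.snd_sub, sub_zero]
    linear_combination w2 ^ n.2.val * d1
  · refine hite _ _ _ _ _ _ (hsub _) ?_
    rintro rfl
    simp only [Prod.fst_add, Prod.snd_add, add_zero]
    linear_combination w1 ^ n.1.val * u2
  · refine hite _ _ _ _ _ _ (by rw [sub_eq_add_neg, hsub, neg_neg]) ?_
    rintro rfl
    simp only [Prod.fst_sub, Prod.snd_sub, sub_zero]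
    linear_combination w1 ^ n.1.val * d2
  · refine hite _ _ _ _ _ _ (by rw [add_sub_assoc, hsub]; abel_nf) ?_
    rintro rfl
    simp only [Prod.fst_add, Prod.snd_add, Prod.fst_sub, Prod.snd_sub, sub_zero, add_zero]
    linear_combination (w2 ^ n.2.val * w2⁻¹) * u1
      + (if n.1.val = q1 - 1 then w1 ^ q1 else 1) * w1 ^ (n.1 + 1).val * d2
  · refine hite _ _ _ _ _ _ (by rw [sub_add, sub_eq_add_neg, hsub]; abel_nf) ?_
    rintro rfl
    simp only [Prod.fst_add, Prod.snd_add, Prod.fst_sub, Prod.snd_sub, sub_zero, add_zero]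
    linear_combination (w2 ^ n.2.val * w2) * d1
      + (if n.1.val = 0 then (w1 ^ q1)⁻¹ else 1) * w1 ^ (n.1 - 1).val * u2
  · refine hite _ _ _ _ _ _ eq_comm ?_
    rintro rfl
    ring

theorem trace_triMat_pow (V : ZMod q1 × ZMod q2 → ℂ) {w1 w2 : ℂ} (h1 : w1 ≠ 0) (h2 : w2 ≠ 0)
    (N : ℕ) :
    (triMat q1 q2 V (w1 ^ q1) (w2 ^ q2) ^ N).trace
      = ((Matrix.circulant (hop w1 w1⁻¹ w2 w2⁻¹ (w1 * w2⁻¹) (w1⁻¹ * w2))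
            + Matrix.diagonal V) ^ N).trace := by
  set g : ZMod q1 × ZMod q2 → ℂ := fun n => w1 ^ n.1.val * w2 ^ n.2.val with hg
  have hgne : ∀ n, g n ≠ 0 := fun n => mul_ne_zero (pow_ne_zero _ h1) (pow_ne_zero _ h2)
  have hinv : Matrix.diagonal g * Matrix.diagonal (fun n => (g n)⁻¹) = 1 := by
    rw [Matrix.diagonal_mul_diagonal]
    simp [hgne]
  have hinv' : Matrix.diagonal (fun n => (g n)⁻¹) * Matrix.diagonal g = 1 := by
    rw [Matrix.diagonal_mul_diagonal]
    simp [hgne]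
  have hsemi : SemiconjBy (Matrix.diagonal g)
      (Matrix.circulant (hop w1 w1⁻¹ w2 w2⁻¹ (w1 * w2⁻¹) (w1⁻¹ * w2)) + Matrix.diagonal V)
      (triMat q1 q2 V (w1 ^ q1) (w2 ^ q2)) := (triMat_mul_diagonal V h1 h2).symm
  have hpow := (hsemi.pow_right N).eq
  rw [← mul_one (triMat q1 q2 V (w1 ^ q1) (w2 ^ q2) ^ N), ← hinv, ← mul_assoc, ← hpow,
    Matrix.trace_mul_comm, ← mul_assoc, hinv', one_mul]

end Gauge

section Isospectral

variable {q1 q2 : ℕ} [NeZero q1] [NeZero q2] {V Y : ZMod q1 × ZMod q2 → ℂ}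

theorem TriFloquetIso.charpoly_eq (h : TriFloquetIso q1 q2 V Y) {z1 z2 : ℂ}
    (h1 : ‖z1‖ = 1) (h2 : ‖z2‖ = 1) :
    (triMat q1 q2 V z1 z2).charpoly = (triMat q1 q2 Y z1 z2).charpoly := by
  have key : ∀ z : ℂ, ‖z‖ = 1 → ∃ k : ℝ, Complex.exp (2 * Real.pi * Complex.I * k) = z := by
    intro z hz
    obtain ⟨θ, hθ⟩ := (Complex.norm_eq_one_iff z).mp hz
    refine ⟨θ / (2 * Real.pi), ?_⟩
    rw [← hθ]
    congr 1
    have : (Real.pi : ℂ) ≠ 0 := by exact_mod_cast Real.pi_ne_zero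
    push_cast
    field_simp
  obtain ⟨k1, rfl⟩ := key z1 h1
  obtain ⟨k2, rfl⟩ := key z2 h2
  exact h k1 k2

theorem TriFloquetIso.trace_pow_eq (h : TriFloquetIso q1 q2 V Y) {w1 w2 : ℂ}
    (h1 : ‖w1‖ = 1) (h2 : ‖w2‖ = 1) (N : ℕ) :
    ((Matrix.circulant (hop w1 w1⁻¹ w2 w2⁻¹ (w1 * w2⁻¹) (w1⁻¹ * w2)) + Matrix.diagonal V) ^ N).trace
      = ((Matrix.circulant (hop w1 w1⁻¹ w2 w2⁻¹ (w1 * w2⁻¹) (w1⁻¹ * w2))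
          + Matrix.diagonal Y) ^ N).trace := by
  have n1 : w1 ≠ 0 := norm_ne_zero_iff.mp (by rw [h1]; exact one_ne_zero)
  have n2 : w2 ≠ 0 := norm_ne_zero_iff.mp (by rw [h2]; exact one_ne_zero)
  rw [← trace_triMat_pow V n1 n2, ← trace_triMat_pow Y n1 n2]
  exact trace_pow_eq_of_charpoly_eq (h.charpoly_eq (by simp [h1]) (by simp [h2])) N

theorem TriFloquetIso.sum_eq (h : TriFloquetIso q1 q2 V Y) : ∑ n, V n = ∑ n, Y n := by
  have := h.trace_pow_eq (w1 := 1) (w2 := 1) (by simp) (by simp) 1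
  simpa only [pow_one, Matrix.trace_add, Matrix.trace_diagonal, add_right_inj] using this

theorem TriFloquetIso.sum_sq_eq (h : TriFloquetIso q1 q2 V Y) :
    ∑ n, V n ^ 2 = ∑ n, Y n ^ 2 := by
  have := h.trace_pow_eq (w1 := 1) (w2 := 1) (by simp) (by simp) 2
  simp only [pow_two, mul_add, add_mul, Matrix.trace_add, trace_circulant_mul_diagonal,
    Matrix.trace_mul_comm (Matrix.diagonal _) (Matrix.circulant _), h.sum_eq,
    Matrix.diagonal_mul_diagonal, Matrix.trace_diagonal] at this
  simp only [pow_two]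
  linear_combination this

theorem infinite_norm_eq_one : {s : ℂ | ‖s‖ = 1}.Infinite := by
  have h : IsConnected (Metric.sphere (0 : ℂ) 1) :=
    isConnected_sphere (by rw [Complex.rank_real_complex]; exact Cardinal.one_lt_two) 0 zero_le_one
  have hinf := h.isPreconnected.infinite_of_nontrivial
    ⟨1, by simp, -1, by simp, fun h => by norm_num [Complex.ext_iff] at h⟩
  refine hinf.mono fun s hs => ?_
  simpa using hs

theorem TriFloquetIso.sum_autocorr_eq (h : TriFloquetIso q1 q2 V Y) (e : ZMod q1 × ZMod q2)
    (a1 a2 b1 b2 c1 c2 : Polynomial ℂ)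
    (h0 : ∀ d : ZMod q1 × ZMod q2,
      (hop a1 a2 b1 b2 c1 c2 d).eval 0 = if d = -e then 1 else 0)
    (hw : ∀ s : ℂ, ‖s‖ = 1 → ∃ w1 w2 : ℂ, ‖w1‖ = 1 ∧ ‖w2‖ = 1 ∧
      a1.eval s = s ^ 2 * w1 ∧ a2.eval s = s ^ 2 * w1⁻¹ ∧
      b1.eval s = s ^ 2 * w2 ∧ b2.eval s = s ^ 2 * w2⁻¹ ∧
      c1.eval s = s ^ 2 * (w1 * w2⁻¹) ∧ c2.eval s = s ^ 2 * (w1⁻¹ * w2))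
    (m : ℕ) (hm : m • e = 0) :
    ∑ b ∈ Finset.range (m + 1), autocorr V (b • e)
      = ∑ b ∈ Finset.range (m + 1), autocorr Y (b • e) := by
  refine sum_autocorr_eq_of_trace_pow_eq (hop a1 a2 b1 b2 c1 c2) e h0 V Y h.sum_eq m hm _
    infinite_norm_eq_one fun s hs => ?_
  obtain ⟨w1, w2, hw1, hw2, ha1, ha2, hb1, hb2, hc1, hc2⟩ := hw s hs
  have hcirc : Matrix.circulant (fun d : ZMod q1 × ZMod q2 =>
        (hop a1 a2 b1 b2 c1 c2 d).eval s)
      = s ^ 2 • Matrix.circulant (hop w1 w1⁻¹ w2 w2⁻¹ (w1 * w2⁻¹) (w1⁻¹ * w2)) := by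
    ext i j
    rw [Matrix.smul_apply, Matrix.circulant_apply, Matrix.circulant_apply, smul_eq_mul, mul_hop,
      eval_hop, ha1, ha2, hb1, hb2, hc1, hc2]
  rw [hcirc, ← smul_add, ← smul_add, smul_pow, smul_pow, Matrix.trace_smul, Matrix.trace_smul,
    h.trace_pow_eq hw1 hw2]

open Polynomial in
theorem TriFloquetIso.sum_autocorr_snd_eq (h : TriFloquetIso q1 q2 V Y) :
    ∑ b ∈ Finset.range (q2 + 1), autocorr V (b • (0, 1))
      = ∑ b ∈ Finset.range (q2 + 1), autocorr Y (b • (0, 1)) := by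
  refine h.sum_autocorr_eq (0, 1) X (X ^ 3) 1 (X ^ 4) (X ^ 3) X ?_ ?_ q2 (by simp)
  · intro d
    rw [eval_hop]
    simp [hop]
  · intro s hs
    have hs0 : s ≠ 0 := norm_ne_zero_iff.mp (by rw [hs]; exact one_ne_zero)
    refine ⟨s⁻¹, (s ^ 2)⁻¹, by simp [hs], by simp [hs], ?_⟩
    simp only [eval_X, eval_pow, eval_one]
    refine ⟨?_, ?_, ?_, ?_, ?_, ?_⟩ <;> field_simp

open Polynomial in
theorem TriFloquetIso.sum_autocorr_fst_eq (h : TriFloquetIso q1 q2 V Y) :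
    ∑ b ∈ Finset.range (q1 + 1), autocorr V (b • (1, 0))
      = ∑ b ∈ Finset.range (q1 + 1), autocorr Y (b • (1, 0)) := by
  refine h.sum_autocorr_eq (1, 0) 1 (X ^ 4) X (X ^ 3) X (X ^ 3) ?_ ?_ q1 (by simp)
  · intro d
    rw [eval_hop]
    simp [hop]
  · intro s hs
    have hs0 : s ≠ 0 := norm_ne_zero_iff.mp (by rw [hs]; exact one_ne_zero)
    refine ⟨(s ^ 2)⁻¹, s⁻¹, by simp [hs], by simp [hs], ?_⟩
    simp only [eval_X, eval_pow, eval_one]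
    refine ⟨?_, ?_, ?_, ?_, ?_, ?_⟩ <;> field_simp

theorem sum_range_natCast_zmod {q : ℕ} [NeZero q] (f : ZMod q → ℂ) :
    ∑ b ∈ Finset.range q, f b = ∑ x, f x := by
  refine Finset.sum_bij' (fun b _ => (b : ZMod q)) (fun x _ => x.val) ?_ ?_ ?_ ?_ ?_
  · simp
  · intro x _
    exact Finset.mem_range.mpr x.val_lt
  · intro b hb
    exact ZMod.val_cast_of_lt (Finset.mem_range.mp hb)
  · simp
  · simp

theorem sum_mul_sum_translate {q : ℕ} [NeZero q] (f : ZMod q → ℂ) :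
    ∑ x : ZMod q, ∑ y, f y * f (y + x) = (∑ y, f y) ^ 2 := by
  rw [Finset.sum_comm, pow_two, Finset.sum_mul]
  refine Finset.sum_congr rfl fun y _ => ?_
  rw [← Finset.mul_sum, ← Equiv.sum_comp (Equiv.addLeft y) f]
  rfl

theorem sum_autocorr_snd (U : ZMod q1 × ZMod q2 → ℂ) :
    ∑ b ∈ Finset.range (q2 + 1), autocorr U (b • (0, 1))
      = ∑ n1, (∑ n2, U (n1, n2)) ^ 2 + ∑ n, U n ^ 2 := by
  rw [Finset.sum_range_succ]
  congr 1
  · have : ∀ b : ℕ, autocorr U (b • (0, 1)) = (fun x : ZMod q2 => autocorr U (0, x)) b := by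
      intro b
      simp
    rw [Finset.sum_congr rfl fun b _ => this b,
      sum_range_natCast_zmod fun x : ZMod q2 => autocorr U (0, x)]
    simp only [autocorr, Fintype.sum_prod_type, Prod.mk_add_mk, add_zero]
    rw [Finset.sum_comm]
    exact Finset.sum_congr rfl fun n1 _ => sum_mul_sum_translate fun n2 => U (n1, n2)
  · have : q2 • ((0, 1) : ZMod q1 × ZMod q2) = 0 := by simp
    rw [this]
    simp [autocorr, pow_two]

theorem sum_autocorr_fst (U : ZMod q1 × ZMod q2 → ℂ) :
    ∑ b ∈ Finset.range (q1 + 1), autocorr U (b • (1, 0))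
      = ∑ n2, (∑ n1, U (n1, n2)) ^ 2 + ∑ n, U n ^ 2 := by
  rw [Finset.sum_range_succ]
  congr 1
  · have : ∀ b : ℕ, autocorr U (b • (1, 0)) = (fun x : ZMod q1 => autocorr U (x, 0)) b := by
      intro b
      simp
    rw [Finset.sum_congr rfl fun b _ => this b,
      sum_range_natCast_zmod fun x : ZMod q1 => autocorr U (x, 0)]
    simp only [autocorr, Fintype.sum_prod_type_right, Prod.mk_add_mk, add_zero]
    rw [Finset.sum_comm]
    exact Finset.sum_congr rfl fun n2 _ => sum_mul_sum_translate fun n1 => U (n1, n2)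
  · have : q1 • ((1, 0) : ZMod q1 × ZMod q2) = 0 := by simp
    rw [this]
    simp [autocorr, pow_two]

theorem TriFloquetIso.sum_sq_sum_snd_eq (h : TriFloquetIso q1 q2 V Y) :
    ∑ n1, (∑ n2, V (n1, n2)) ^ 2 = ∑ n1, (∑ n2, Y (n1, n2)) ^ 2 := by
  have := h.sum_autocorr_snd_eq
  rwa [sum_autocorr_snd, sum_autocorr_snd, h.sum_sq_eq, add_left_inj] at this

theorem TriFloquetIso.sum_sq_sum_fst_eq (h : TriFloquetIso q1 q2 V Y) :
    ∑ n2, (∑ n1, V (n1, n2)) ^ 2 = ∑ n2, (∑ n1, Y (n1, n2)) ^ 2 := by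
  have := h.sum_autocorr_fst_eq
  rwa [sum_autocorr_fst, sum_autocorr_fst, h.sum_sq_eq, add_left_inj] at this

end Isospectral

section Parseval

theorem exp_eq_stdAddChar {q : ℕ} [NeZero q] (l n : ZMod q) :
    Complex.exp (-(2 * Real.pi * Complex.I) * ((l.val : ℂ) * (n.val : ℂ) / (q : ℂ)))
      = ZMod.stdAddChar (-(l * n)) := by
  have h : -(l * n) = ((-((l.val : ℤ) * (n.val : ℤ)) : ℤ) : ZMod q) := by simp
  rw [h, ZMod.stdAddChar_coe]
  congr 1
  push_cast
  ring

theorem conj_stdAddChar {q : ℕ} [NeZero q] (x : ZMod q) :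
    (starRingEnd ℂ) (ZMod.stdAddChar x) = ZMod.stdAddChar (-x) := by
  rw [ZMod.stdAddChar_apply, ZMod.stdAddChar_apply, ← Circle.coe_inv_eq_conj,
    AddChar.map_neg_eq_inv]

/-- Parseval's identity on `ZMod q`. -/
theorem sum_normSq_sum_mul_stdAddChar {q : ℕ} [NeZero q] (f : ZMod q → ℂ) :
    ∑ l : ZMod q, Complex.normSq (∑ n, f n * ZMod.stdAddChar (-(l * n)))
      = q * ∑ n, Complex.normSq (f n) := by
  apply Complex.ofReal_injective
  push_cast
  simp only [← Complex.mul_conj, map_sum, map_mul, conj_stdAddChar, neg_neg]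
  have hterm : ∀ l : ZMod q, (∑ n, f n * ZMod.stdAddChar (-(l * n)))
        * ∑ m, (starRingEnd ℂ) (f m) * ZMod.stdAddChar (l * m)
      = ∑ n, ∑ m, f n * (starRingEnd ℂ) (f m) * ZMod.stdAddChar (l * (m - n)) := by
    intro l
    rw [Finset.sum_mul_sum]
    refine Finset.sum_congr rfl fun n _ => Finset.sum_congr rfl fun m _ => ?_
    have : l * (m - n) = -(l * n) + l * m := by ring
    rw [this, AddChar.map_add_eq_mul]
    ring
  rw [Finset.sum_congr rfl fun l _ => hterm l, Finset.sum_comm, Finset.mul_sum]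
  refine Finset.sum_congr rfl fun n _ => ?_
  rw [Finset.sum_comm]
  simp only [← Finset.mul_sum, AddChar.sum_mulShift _ (ZMod.isPrimitive_stdAddChar q), sub_eq_zero]
  simp [mul_comm]

variable {q1 q2 : ℕ} [NeZero q1] [NeZero q2] (U : ZMod q1 × ZMod q2 → ℂ)

theorem triDft_eq (l : ZMod q1 × ZMod q2) :
    triDft q1 q2 U l = (1 / ((q1 : ℂ) * (q2 : ℂ))) * ∑ n2, (∑ n1, U (n1, n2)
      * ZMod.stdAddChar (-(l.1 * n1))) * ZMod.stdAddChar (-(l.2 * n2)) := by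
  rw [triDft, Fintype.sum_prod_type_right]
  congr 1
  refine Finset.sum_congr rfl fun n2 _ => ?_
  rw [Finset.sum_mul]
  refine Finset.sum_congr rfl fun n1 _ => ?_
  rw [mul_add, Complex.exp_add, exp_eq_stdAddChar, exp_eq_stdAddChar, mul_assoc]

theorem sum_normSq_triDft :
    ∑ l, Complex.normSq (triDft q1 q2 U l)
      = Complex.normSq (1 / ((q1 : ℂ) * (q2 : ℂ))) * (q2 * (q1 * ∑ n, Complex.normSq (U n))) := by
  simp only [triDft_eq, Complex.normSq_mul, ← Finset.mul_sum]
  congr 1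
  rw [Fintype.sum_prod_type]
  simp only [sum_normSq_sum_mul_stdAddChar]
  rw [← Finset.mul_sum, Finset.sum_comm]
  simp only [sum_normSq_sum_mul_stdAddChar]
  rw [← Finset.mul_sum, Fintype.sum_prod_type_right]

theorem sum_normSq_triDft_fst :
    ∑ l1, Complex.normSq (triDft q1 q2 U (l1, 0))
      = Complex.normSq (1 / ((q1 : ℂ) * (q2 : ℂ)))
        * (q1 * ∑ n1, Complex.normSq (∑ n2, U (n1, n2))) := by
  simp only [triDft_eq, Complex.normSq_mul, ← Finset.mul_sum]
  congr 1
  rw [← sum_normSq_sum_mul_stdAddChar]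
  refine Finset.sum_congr rfl fun l1 _ => ?_
  simp only [zero_mul, neg_zero, AddChar.map_zero_eq_one, mul_one]
  rw [Finset.sum_comm]
  simp only [Finset.sum_mul]

theorem sum_normSq_triDft_snd :
    ∑ l2, Complex.normSq (triDft q1 q2 U (0, l2))
      = Complex.normSq (1 / ((q1 : ℂ) * (q2 : ℂ)))
        * (q2 * ∑ n2, Complex.normSq (∑ n1, U (n1, n2))) := by
  simp only [triDft_eq, Complex.normSq_mul, ← Finset.mul_sum]
  congr 1
  rw [← sum_normSq_sum_mul_stdAddChar]
  simp only [zero_mul, neg_zero, AddChar.map_zero_eq_one, mul_one]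

end Parseval

/-- For real-valued Tri-Floquet isospectral potentials `V, Y`:
(i) `[V] = [Y]`; (ii) `Σ_{l∈W} |V̂(l)|² = Σ_{l∈W} |Ŷ(l)|²`;
(iii) `Σ_{l₁} |V̂(l₁,0)|² = Σ_{l₁} |Ŷ(l₁,0)|²`; (iv) `Σ_{l₂} |V̂(0,l₂)|² = Σ_{l₂} |Ŷ(0,l₂)|²`. -/
theorem stmt15 (q1 q2 : ℕ) [NeZero q1] [NeZero q2]
    (V Y : ZMod q1 × ZMod q2 → ℝ)
    (hiso : TriFloquetIso q1 q2 (fun n => (V n : ℂ)) (fun n => (Y n : ℂ))) :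
    triAvg q1 q2 (fun n => (V n : ℂ)) = triAvg q1 q2 (fun n => (Y n : ℂ))
    ∧ (∑ l : ZMod q1 × ZMod q2, Complex.normSq (triDft q1 q2 (fun n => (V n : ℂ)) l)
        = ∑ l : ZMod q1 × ZMod q2, Complex.normSq (triDft q1 q2 (fun n => (Y n : ℂ)) l))
    ∧ (∑ l1 : ZMod q1, Complex.normSq (triDft q1 q2 (fun n => (V n : ℂ)) (l1, 0))
        = ∑ l1 : ZMod q1, Complex.normSq (triDft q1 q2 (fun n => (Y n : ℂ)) (l1, 0)))
    ∧ (∑ l2 : ZMod q2, Complex.normSq (triDft q1 q2 (fun n => (V n : ℂ)) (0, l2))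
        = ∑ l2 : ZMod q2, Complex.normSq (triDft q1 q2 (fun n => (Y n : ℂ)) (0, l2))) := by
  have hsq := hiso.sum_sq_eq
  have hfst := hiso.sum_sq_sum_snd_eq
  have hsnd := hiso.sum_sq_sum_fst_eq
  refine ⟨?_, ?_, ?_, ?_⟩
  · rw [triAvg, triAvg, hiso.sum_eq]
  · rw [sum_normSq_triDft, sum_normSq_triDft]
    simp only [Complex.normSq_ofReal, ← pow_two]
    congr 3
    exact_mod_cast hsq
  · rw [sum_normSq_triDft_fst, sum_normSq_triDft_fst]
    simp only [← Complex.ofReal_sum, Complex.normSq_ofReal, ← pow_two]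
    congr 2
    exact_mod_cast hfst
  · rw [sum_normSq_triDft_snd, sum_normSq_triDft_snd]
    simp only [← Complex.ofReal_sum, Complex.normSq_ofReal, ← pow_two]
    congr 2
    exact_mod_cast hsnd

end TriDPSO
end
end
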